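/- There exists a real number λ with 1.4453300117 ≤ λ ≤ 1.4453300118 such that: (i) the sequence of ratios of the number of digits in successive terms of the stuttering look and say sequence with seed 0 converges to λ, i.e. the sequence n ↦ (length of say^[n+1]([0])) / (length of say^[n]([0])) tends to λ as n → ∞; and (ii) λ is an algebraic integer whose minimal polynomial over ℚ has degree 415. -/

import Mathlib

/-- Replace a maximal run `d^n` (given as a nonempty constant list) by `n^n d`:
the base-`b` digits of `n` (most significant first), concatenated `n` times,
followed by the single digit `d`. -/
def sayRun {b : ℕ} : List (Fin b) → List (Fin b)
  | [] => []
  | d :: t =>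
      (List.replicate (t.length + 1)
        ((Nat.digits b (t.length + 1)).reverse.map
          (fun k => (⟨k % b, Nat.mod_lt k d.pos⟩ : Fin b)))).flatten ++ [d]

/-- The stuttering say-what-you-see operation: decompose a string into its
maximal runs and replace each run `d^n` by `n^n d`. -/
def say {b : ℕ} (S : List (Fin b)) : List (Fin b) :=
  ((S.splitBy (· == ·)).map sayRun).flatten

/-! ## Part A: strings -/

/-- force a natural number to a literal -/
def forceN {α : Type} (n : ℕ) (k : ℕ → α) : α :=
  Nat.rec (motive := fun _ => α) (k 0) (fun m _ => k (Nat.succ m)) n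

theorem forceN_eq {α : Type} (n : ℕ) (k : ℕ → α) : forceN n k = k n := by
  cases n <;> rfl

def digsN (n : ℕ) : List ℕ :=
  bif Nat.ble 10 n then
    (bif Nat.ble 100 n then (Nat.digits 10 n).reverse else [n / 10, n % 10])
  else (bif Nat.beq n 0 then [] else [n])

theorem ble_tt {a b : ℕ} (h : a ≤ b) : Nat.ble a b = true := Nat.ble_eq_true_of_le h
theorem ble_ff {a b : ℕ} (h : ¬ a ≤ b) : Nat.ble a b = false := by
  rw [← Bool.not_eq_true, Nat.ble_eq]; exact h
theorem beq_ff {a b : ℕ} (h : ¬ a = b) : Nat.beq a b = false := by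
  rw [← Bool.not_eq_true, Nat.beq_eq]; exact h

theorem digsN_eq (n : ℕ) : digsN n = (Nat.digits 10 n).reverse := by
  unfold digsN
  by_cases h : 10 ≤ n
  · by_cases h2 : 100 ≤ n
    · rw [ble_tt h, ble_tt h2]; rfl
    · have h3 : n < 100 := by omega
      rw [ble_tt h, ble_ff h2]
      clear h2
      interval_cases n <;> simp
  · have h3 : n < 10 := by omega
    rw [ble_ff h]
    clear h
    interval_cases n <;> simp [Nat.beq]

def emitN (n d : ℕ) : List ℕ := (List.replicate n (digsN n)).flatten ++ [d]

def sayA (l : List ℕ) : ℕ → ℕ → List ℕ :=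
  List.rec (motive := fun _ => ℕ → ℕ → List ℕ) (fun d n => emitN n d)
    (fun e _ ih d n => bif Nat.beq d e then ih d (n + 1) else emitN n d ++ ih e 1) l

theorem sayA_nil (d n : ℕ) : sayA [] d n = emitN n d := rfl
theorem sayA_cons (e : ℕ) (l : List ℕ) (d n : ℕ) : sayA (e :: l) d n =
    if d = e then sayA l d (n + 1) else emitN n d ++ sayA l e 1 := by
  change (bif Nat.beq d e then sayA l d (n + 1) else emitN n d ++ sayA l e 1) = _
  by_cases h : d = e
  · simp [h]
  · rw [beq_ff h]; simp [h]

def sayN (l : List ℕ) : List ℕ :=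
  List.rec (motive := fun _ => List ℕ) [] (fun d t _ => sayA t d 1) l

theorem sayN_cons (d : ℕ) (l : List ℕ) : sayN (d :: l) = sayA l d 1 := rfl

theorem sayRun_val (d : Fin 10) (t : List (Fin 10)) :
    (sayRun (d :: t)).map Fin.val = emitN (t.length + 1) d.val := by
  simp only [sayRun, emitN, digsN_eq, List.map_append, List.map_flatten, List.map_replicate,
    List.map_map, List.map_cons, List.map_nil]
  congr 3
  conv_rhs => rw [← List.map_id (Nat.digits 10 (t.length + 1)).reverse]
  apply List.map_congr_left
  intro k hk
  have : k < 10 := Nat.digits_lt_base (by norm_num) (List.mem_reverse.1 hk)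
  simp [Nat.mod_eq_of_lt this]

theorem sayRun_rep (d : Fin 10) (g : List (Fin 10)) (hg : ∀ x ∈ g, x = d) :
    (sayRun (d :: g).reverse).map Fin.val = emitN (g.length + 1) d.val := by
  have h1 : d :: g = List.replicate (g.length + 1) d := by
    rw [List.eq_replicate_iff]
    refine ⟨by simp, ?_⟩
    intro b hb
    rcases List.mem_cons.1 hb with h | h
    · exact h
    · exact hg _ h
  rw [h1, List.reverse_replicate, List.replicate_succ, sayRun_val, List.length_replicate]

theorem loop_val (l : List (Fin 10)) : ∀ (d : Fin 10) (g : List (Fin 10)) (gs : List (List (Fin 10))),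
    (∀ x ∈ g, x = d) →
    (((List.splitBy.loop (· == ·) l d g gs).map sayRun).flatten).map Fin.val =
      ((gs.reverse.map sayRun).flatten).map Fin.val ++ sayA (l.map Fin.val) d.val (g.length + 1) := by
  induction l with
  | nil =>
    intro d g gs hg
    simp only [List.splitBy.loop, List.map_nil, sayA_nil]
    rw [← sayRun_rep d g hg]
    simp
  | cons e l ih =>
    intro d g gs hg
    rw [List.splitBy.loop, List.map_cons, sayA_cons]
    by_cases h : d = e
    · subst h
      simp only [beq_self_eq_true, if_true]
      rw [ih d (d :: g) gs]
      · simp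
      · intro x hx
        rcases List.mem_cons.1 hx with h | h
        · exact h
        · exact hg _ h
    · have h' : ¬ d.val = e.val := fun q => h (Fin.ext q)
      have h2 : (d == e) = false := by simpa using h
      rw [h2]
      simp only [h', if_false]
      rw [ih e [] _ (by simp)]
      rw [← sayRun_rep d g hg]
      simp

theorem say_val (S : List (Fin 10)) : (say S).map Fin.val = sayN (S.map Fin.val) := by
  cases S with
  | nil => rfl
  | cons d l =>
    rw [say, List.splitBy, loop_val l d [] [] (by simp)]
    simp [sayN_cons]

theorem iter_val (n : ℕ) (S : List (Fin 10)) :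
    (say^[n] S).map Fin.val = sayN^[n] (S.map Fin.val) := by
  induction n with
  | zero => rfl
  | succ n ih => rw [Function.iterate_succ_apply', say_val, ih, Function.iterate_succ_apply']

theorem sayA_append (A : List ℕ) : ∀ (d n b : ℕ) (B : List ℕ),
    (d :: A).getLast (by simp) ≠ b → sayA (A ++ b :: B) d n = sayA A d n ++ sayN (b :: B) := by
  induction A with
  | nil =>
    intro d n b B h
    have h' : d ≠ b := by simpa using h
    simp [sayA_cons, h', sayA_nil, sayN_cons]
  | cons e A ih =>
    intro d n b B h
    rw [List.getLast_cons (by simp)] at h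
    rw [List.cons_append, sayA_cons, sayA_cons]
    by_cases hd : d = e
    · subst hd; simp only [if_true]; exact ih _ _ _ _ h
    · simp only [hd, if_false, ih _ _ _ _ h, List.append_assoc]

theorem sayN_append (A B : List ℕ) (hA : A ≠ [])
    (h : ∀ b ∈ B.head?, A.getLast hA ≠ b) : sayN (A ++ B) = sayN A ++ sayN B := by
  cases A with
  | nil => exact absurd rfl hA
  | cons d A =>
    cases B with
    | nil => simp [sayN]
    | cons b B =>
      rw [List.cons_append, sayN_cons, sayN_cons]
      exact sayA_append _ _ _ _ _ (h b (by simp))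


@[irreducible] def molT : List (List ℕ) := [
[101, 10111, 1011333, 1223333, 12222234444, 1222555553144444, 12223335555553111455555, 12223333333566666631133341555555, 122333341115666666, 122233337777777516666666311, 12222234444411333516666666, 12223333444477777777511167777777311, 1223333511167777777, 122255555314555551, 122233334444444447888888885113336177777777311, 1222344445113336177777777, 122233355555531114155555511, 12233336111788888888311, 122233334444499999999971888888888511, 12233336111788888888, 12223333144444511, 122233333335666666311333411156666661, 1222223444461133371888888888311, 122233334444455555999999999971118999999999511, 1222223444461133371888888888, 123333444411455555511, 122333341133351666666611, 122333371118999999999311],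
[1222555553144444611, 101711333819999999999511, 1222333344444555555555559, 122333371118999999999, 1224156666661, 1222134444444441, 12233335111677777771, 12222234444411, 12222234444711333819999999999311, 12223335555553111455555611, 101511, 122333381119, 10111711, 1222333344444555555111111111111111111111191, 12222234444711333819999999999, 123335555553111455555611, 1222411151666666611, 123331131499999999911, 12222234444511333617777777711, 101311, 1222555553144444711, 12223333333566666631133341555555611, 10111511, 1222223444481133391, 1011333711, 1222222222222222222222222222222222222222222229111, 12223333444445555556666661, 122213333566666631133341555555611],
[12223334113335111677777771, 12231114199999999991, 1222133331, 122333361117888888881, 12555553144444511, 10111311, 12223335555553111455555711, 122333341115666666611, 1011333511, 12233339111, 1222555553144444811, 1223333711, 124444444444444444444444444444444444444444444444444444444444444444444444444444444444444444911333, 1222333344444555555666666666666611, 123331134444516666666311, 1223333511333617777777711, 123333333411, 122231133341119, 12333113444411, 122222344446113337188888888811, 122215555553111455555511, 1011333311, 12223333333566666631133341555555711, 1222223444441133351677777771, 1223333511, 12222234444911333, 12223335555553111455555811, 12222234444711],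
[12221488888888888888888888888888888888888888888888888888888888888888888888888888888888888888888888888888888888888888888888888888888888888888888888888888888888888888888888888888888888911, 12223333444445555556666666313131313131313131313131311, 1223144444511167777777311, 12222234444511, 12137777777411, 122333341133391, 1222333311, 12231444441, 1223333711189999999991, 123331156666663113334156666661, 122344441, 122333341115666666711, 1233337777777516666666311, 12233335111617777777711, 1222555553144444911, 12223333333566666631133341555555811, 122233311418671671671671671671671671671671671671671671671671671671671671671671671671671671671671671671671671671671671671671671671671671671671671671671671671671671671671671671671671671671671671671671671671671671671671671671671671671671671671671671671671671671671671671671671671671671671671671671671671671671671671671671671671671671671671671671671671671671671671671671671671671671671671671671671671671671671671671671671671671671671671671671671671671671671671671671671671671671671671671671671671671671671671671671671671671671671671671671671671911, 122233334444455555566666667777777311131113111311131113111311131113111311131113111311, 122231114555555113336177777777311, 1222555553144444511, 121113177777777411, 12333344441, 1222311145555511, 1222223444471133381999999999911, 1223333411151666666611, 122516666666311, 12333344444555555111111111111111111111191, 122222314444411],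
[12222234444411333516666666711, 122213444477777777511167777777311, 12223444451133361117888888881, 12223335555553111455555911, 122333341115666666811, 122411181617111617111617111617111617111617111617111617111617111617111617111617111617111617111617111617111617111617111617111617111617111617111617111617111617111617111617111617111617111617111617111617111617111617111617111617111617111617111617111617111617111617111617111617111617111617111617111617111617111617111617111617111617111617111617111617111617111617111617111617111617111617111617111617111617111617111617111617111617111617111617111617111617111617111617111617111617111617111617111617111617111617111617111617111617111617111617111617111617111617111617111617111617111617111617111617111617111617111617111617111617111617111617111617111617111617111617111617111617111617111617111617111617111617111617111617111617111617111617111617111617111617111617111617111617111617111617111617111617111617111617111617111617111617111617111617111617111617111617111617111617111617111617111617111617111617111617111617111617111617111617111617111617111617111617111617111617111617111617111617111617111617111617111617111617111617111617111617111617111617111617111617111617111617111617111617111911, 122233333331, 12223333444445555556666666777777777777777311333311333311333311333311333311333311333311333311333311333311333311333311, 12223333113334156666661, 12223335555553111455555511, 12113333111788888888411, 1255555314555551, 12221344444444411, 1222333311333415555551, 122222344444113335111677777771, 1222511167777777311, 122213444445555556666661, 12225555531114555551, 1223333511167777777711, 123331131444447888888885113336177777777311, 12233336113337188888888811, 12223333333566666631133341555555911,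 12222234444411333516666666811, 1222411333811161117113336111711333611171133361117113336111711333611171133361117113336111711333611171133361117113336111711333611171133361117113336111711333611171133361117113336111711333611171133361117113336111711333611171133361117113336111711333611171133361117113336111711333611171133361117113336111711333611171133361117113336111711333611171133361117113336111711333611171133361117113336111711333611171133361117113336111711333611171133361117113336111711333611171133361117113336111711333611171133361117113336111711333611171133361117113336111711333611171133361117113336111711333611171133361117113336111711333611171133361117113336111711333611171133361117113336111711333611171133361117113336111711333611171133361117113336111711333611171133361117113336111711333611171133361117113336111711333611171133361117113336111711333611171133361117113336111711333611171133361117113336111711333611171133361117113336111711333611171133361117113336111711333611171133361117113336111711333611171133361117113336111711333611171133361117113336111711333611171133361117113336111711333611171133361117113336111711333611171133361117113336111711333611171133361117113336111711333611171133361117113336111711333611171133361117113336111711333611171133361117113336111711333611171133361117113336111711333611171133361117113336111711333611171133361117113336111711333611171133361117113336111711333611171133361117113336111711333611171133361117113336111711333611171133361117113336111711333611171133361117113336111711333611171133361117113336111711333611171133361117113336111711333611171133361117113336111711333611171133361117113336111711333611171133361117113336111711333611171133361117113336111711333611171133361117113336111711333611171133361117113336111711333611171133361117113336111711333611171133361117113336111711333911,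 12223333777777711, 1222333344444555555666666677777777515151515151515151515151515151311, 12223444461133371888888888311, 1222333333356666663113334156666661],
[12234444133371888888888411, 12555553144444911, 1222155555531114155555511, 12333113149999999991, 12233334111566666611, 1222333113444411, 12223335113336177777777311, 1233311314555555666666666666611, 12223335555553113334155555511, 122234444511333617888888881, 122311145555571888888888511, 12222234444611, 122333341115666666911, 1223333511167777777811, 1223333911, 1223333611333711, 1223333811333611333711, 1222333411, 1233334444777777771, 1222314444411, 122233334444455555566666667777777788888888511151115111511151115111511151115111511151115111511151115111311, 12223333144444611, 1222344444113335111677777771, 123333333566666631133341555555611, 122222314444411333371118999999999411, 122215555553111455555911, 12333115666666311333411156666661, 122311141999999999911],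
[1222344444113335166666661, 122234444511, 123333333511, 12231114156666666313131313131313131313131311, 1223333411156666661, 122233333335666666311, 1233334444444447888888885113336177777777311, 122333361117188888888811, 12223113334155555571118999999999511, 12222234444411333516666666911, 1222344445113336177777777811, 12222234444911, 1223333611, 12222234444811, 12221344444444478888888811, 122233331114555551, 122233334444455555566666667777777788888888888888888511333511333511333511333511333511333511333511333511333511333511333511333511333511333511333311, 123333444411455555611, 1222333314555551, 1222137777777516666666311, 12234444711333819999999999411, 1233311566666631133341555555911, 122333351116777777711, 1222137777777511, 122231133341115167777777311131113111311131113111311131113111311131113111311, 1222223444441133351666666611, 1222134444499999999971888888888511, 12222234444611333711189999999991],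
[122333341115666666711333819999999999511, 1223333511167777777911, 12233336111788888888811, 1222137777777411, 1233311314999999999718888888881, 123333444413334155555511, 12223333444445555556666666777777778888888887171717171717171717171717171717171511, 12241555555611, 1233334444114155555511, 12333113177777777511167777777311, 101411, 12223144444711, 12223444451133361777777771, 122233334444777777771, 12333113177777777511, 122333341133351116177777777311333311333311333311333311333311333311333311333311333311333311333311333311, 123331131455555999999999971118999999999511, 122333371133381999999999911, 1222344445113336177777777911, 122222344446113337189999999991, 12333113177777777411, 12231114199999999997111899999999911, 122213444444444113333411156666661, 1233333335666666311, 122233334444455555566666667777777788888888899999999971117111711171117111711171117111711171117111711171117111711171117111511, 122241115666666611, 122411156666661, 12231117888888885113336177777777311],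
[10111411, 12223333111455555711, 1223333611178888888811, 1222333344444444478888888811, 1223111788888888511, 12233335113336111788888888311, 122234444511333617777777711, 1223111415555559, 12233336111788888888911, 1233334444455555999999999971118999999999511, 1223333711181999999999911, 1223111788888888411, 1017113338199999999991, 1223444441133351666666611, 12223333444445555556666666777777778888888889999999999999999999711333711333711333711333711333711333711333711333711333711333711333711333711333711333711333711333711333511, 122233341133351677777771, 122241133351666666611, 12223331131499999999911, 122231133371888888888511, 1011333411, 1233334444133341555555711, 12222234444611333718888888881, 1222333344444999999999718888888881, 122333361133371888888888311, 12223113334111566666691, 1222223444461133371888888888911, 12221344444555555555559, 1222223444471133381119],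
[122231133371888888888411, 1222314555551, 1222333344444555555666666677777777888888888999999999991919191919191919191919191919191919191711, 122333371118999999999511, 1223333411, 12221344444444411333341115666666711, 12233337111899999999911, 12223333444445555599999999997111899999999911, 12233334113335166666669111, 123335555553111455555811, 123333444477777777511167777777311, 122333371118999999999911, 122233311314555555111111111111111111111191, 122333381133391, 122333371118999999999411, 12133331, 122233331114155555511, 12223333444445555556666666777777778888888889999999999111111111111111111111111911191119111911191119111911191119111911191119111911191119111911191119111711, 1222223444451133361117888888881, 12222234444711333819999999999511, 12234444411333516666666711, 122222344447113338199999999991, 1223333511167777777911333, 122213333566666631133341555555811, 1222134444444447888888885113336177777777311, 12222234444711333819, 12231114156666661, 12222234444711333819999999999411],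
[121113444411, 1222333344441333411156666661, 12911333911333911333911333911333911333911333911333911333911333911333911333911333911333911333911333911333911333711, 124, 10114, 12223333444445555556666666777777778888888889999999999, 12555553144444711, 122222344445113336177777777911, 123331131499999999971888888888511, 1223333811191, 1222311333411151666666611, 121133331444441, 1222333344444444411333341133351666666611, 121911, 12141, 12241, 122215555553111455555711, 12333344444555555666666666666611, 122311141999999999971118999999999511, 122222344448113339111, 12233334113335111677777771, 122344441145555511, 12234444411, 12223333444449999999991, 12111911, 121114111, 1222224111, 1233311566666631133341555555711],
[122213444445555556666666313131313131313131313131311, 1223333911333, 1233311418671671671671671671671671671671671671671671671671671671671671671671671671671671671671671671671671671671671671671671671671671671671671671671671671671671671671671671671671671671671671671671671671671671671671671671671671671671671671671671671671671671671671671671671671671671671671671671671671671671671671671671671671671671671671671671671671671671671671671671671671671671671671671671671671671671671671671671671671671671671671671671671671671671671671671671671671671671671671671671671671671671671671671671671671671671671671671671671671911, 12333344444555555555559, 122415555551, 12222231444441, 122233334444455555999999999911, 1233334444499999999971888888888511, 1211333911, 1211333411333, 122255555411333, 123331131455555566666667777777311131113111311131113111311131113111311131113111311, 12221344444555555111111111111111111111191,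 12224111566666611, 122255555311145555511, 1222134444455555999999999971118999999999511, 1222333555555411, 12231114156666666777777777777777311333311333311333311333311333311333311333311333311333311333311333311333311, 12333113145555556666661, 12223334113335166666661, 1222333555555311333415555551, 1233311314555555555559, 122233333335666666411, 1222311333411151677777777515151515151515151515151515151311, 123333444445555556666661, 1223111415666666666666611, 1222333113145555556666661, 1223111415111111111111111111111191],
[122233337777777516666666411, 1223333411333511161788888888511151115111511151115111511151115111511151115111511151115111311, 12221344444555555666666666666611, 12223113334111516313131313131313131313131311, 123333444445555556666666313131313131313131313131311, 1222223444451133361777777771, 122222344444113335166666661, 12223113334111511, 123335555553111455555, 12223333444477777777511167777777411, 1223333511333611171888888888511333511333511333511333511333511333511333511333511333511333511333511333511333511333511333311, 12333113145555556666666313131313131313131313131311, 1223333411333511161311131113111311131113111311131113111311131113111311, 1222134444455555566666667777777311131113111311131113111311131113111311131113111311, 12224444444444444444444444444444444444444444444444444444444444444444444444444444444444444444911333, 1223333411333511, 122213333566666631133341555555, 122233334444444447888888885113336177777777411, 122333361133371118999999999511, 1233334444455555566666667777777311131113111311131113111311131113111311131113111311, 122311141566666667777777311131113111311131113111311131113111311131113111311,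 12233335113336111311333311333311333311333311333311333311333311333311333311333311333311333311, 12333113145555556666666777777777777777311333311333311333311333311333311333311333311333311333311333311333311333311, 1222333488888888888888888888888888888888888888888888888888888888888888888888888888888888888888888888888888888888888888888888888888888888888888888888888888888888888888888888888888888888911, 1233311314555555111111111111111111111191, 12233336111788888888411, 1223333711333819999999999511, 122213444445555556666666777777777777777311333311333311333311333311333311333311333311333311333311333311333311333311],
[12223113334111516777777777777777311333311333311333311333311333311333311333311333311333311333311333311333311, 1223333611333311, 1223111415666666677777777515151515151515151515151515151311, 12223333333418671671671671671671671671671671671671671671671671671671671671671671671671671671671671671671671671671671671671671671671671671671671671671671671671671671671671671671671671671671671671671671671671671671671671671671671671671671671671671671671671671671671671671671671671671671671671671671671671671671671671671671671671671671671671671671671671671671671671671671671671671671671671671671671671671671671671671671671671671671671671671671671671671671671671671671671671671671671671671671671671671671671671671671671671671671671671671671671671911, 1222223444461133371888888888411, 1233311314555555666666677777777515151515151515151515151515151311, 12233334113335111617515151515151515151515151515151311, 122231133341115167777777788888888511151115111511151115111511151115111511151115111511151115111311, 1222333377777774111816171116171116171116171116171116171116171116171116171116171116171116171116171116171116171116171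11617111617111617111617111617111617111617111617111617111617111617111617111617111617111617111617111617111617111617111617111617111617111617111617111617111617111617111617111617111617111617111617111617111617111617111617111617111617111617111617111617111617111617111617111617111617111617111617111617111617111617111617111617111617111617111617111617111617111617111617111617111617111617111617111617111617111617111617111617111617111617111617111617111617111617111617111617111617111617111617111617111617111617111617111617111617111617111617111617111617111617111617111617111617111617111617111617111617111617111617111617111617111617111617111617111617111617111617111617111617111617111617111617111617111617111617111617111617111617111617111617111617111617111617111617111617111617111617111617111617111617111617111617111617111617111617111617111617111617111617111617111617111617111617111617111617111617111617111617111617111617111617111617111617111617111617111617111617111617111617111911, 122311141566666667777777788888888511151115111511151115111511151115111511151115111511151115111311, 1223333511333611171511151115111511151115111511151115111511151115111511151115111311, 125555531114555551, 1223333411333511161788888888888888888511333511333511333511333511333511333511333511333511333511333511333511333511333511333511333311, 1222333344447777777741133381116111711333611171133361117113336111711333611171133361117113336111711333611171133361117113336111711333611171133361117113336111711333611171133361117113336111711333611171133361117113336111711333611171133361117113336111711333611171133361117113336111711333611171133361117113336111711333611171133361117113336111711333611171133361117113336111711333611171133361117113336111711333611171133361117113336111711333611171133361117113336111711333611171133361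1171133361117113336111711333611171133361117113336111711333611171133361117113336111711333611171133361117113336111711333611171133361117113336111711333611171133361117113336111711333611171133361117113336111711333611171133361117113336111711333611171133361117113336111711333611171133361117113336111711333611171133361117113336111711333611171133361117113336111711333611171133361117113336111711333611171133361117113336111711333611171133361117113336111711333611171133361117113336111711333611171133361117113336111711333611171133361117113336111711333611171133361117113336111711333611171133361117113336111711333611171133361117113336111711333611171133361117113336111711333611171133361117113336111711333611171133361117113336111711333611171133361117113336111711333611171133361117113336111711333611171133361117113336111711333611171133361117113336111711333611171133361117113336111711333611171133361117113336111711333611171133361117113336111711333611171133361117113336111711333611171133361117113336111711333611171133361117113336111711333611171133361117113336111711333611171133361117113336111711333611171133361117113336111711333611171133361117113336111711333611171133361117113336111711333611171133361117113336111711333611171133361117113336111711333611171133361117113336111711333611171133361117113336111711333611171133361117113336111711333911, 122231133341115167777777788888888888888888511333511333511333511333511333511333511333511333511333511333511333511333511333511333511333311, 12233336113337111511333511333511333511333511333511333511333511333511333511333511333511333511333511333511333311, 122215555553113334155555511, 122333351133361117187171717171717171717171717171717171511, 12223333444444444788888888411, 122333341133351116178888888887171717171717171717171717171717171511, 1223333711333511,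 12333115666666311, 122333361133371118171117111711171117111711171117111711171117111711171117111711171117111511, 1233334444499999999971888888888411, 1223333511333611171899999999971117111711171117111711171117111711171117111711171117111711171117111511, 12233337113338111711333711333711333711333711333711333711333711333711333711333711333711333711333711333711333711333711333511, 1222134444455555999999999971118999999999411, 12233336113337111819999999999711333711333711333711333711333711333711333711333711333711333711333711333711333711333711333711333711333511],
[1223333811333711, 101711333819999999999411, 101711, 122333371133381119, 1011, 1211, 1, 1, 1, 1, 1, 1, 1, 1, 1, 1, 1, 1, 1, 1, 1, 1, 1, 1, 1, 1, 1, 1]]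

@[irreducible] def rowT : List (List ℕ) := [
[100100020000000, 100200040010000, 178600100300060020000, 100400090030085, 100500130040085, 100600180050085, 100700250060085, 100900100800340070085, 101000170080071, 101100290097185, 101300101200250100066, 101400370116685, 101500180120008, 101600170130861, 101800101700470146185, 102000101900240150022, 102100260162256, 102200220175673, 102300380187385, 102400190190028, 102500160202809, 102700102600350210950, 102900102800300225068, 103100900000103000470236885, 103300103200270240022, 103500103400200252223, 103700103600230262371, 103800260097144],
[103900230274441, 104000180284163, 104300104200900000104100230296300, 104400270300085, 104500200310041, 104600180284109, 104700120320901, 104800150330110, 104900190341021, 101300130352166, 105000340116638, 105300105200900000105100310363835, 105400250373558, 105500050385800, 105600110390074, 105700070407400, 105900105800450410085, 105300105201000000280420035, 106000230433523, 106100180442314, 106300106200200451424, 106500106400280462408, 106600101700440146132, 106700050473200, 106800110390054, 106900180485429, 107100107000340492952, 107200070505200],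
[107400107300180510069, 178600107500090526900, 107600480530012, 107700280541285, 107800107000320552910, 108000107900250561000, 108100900000100100190570006, 108200090580611, 108300200591128, 108400160602822, 108500350187326, 108600070612600, 108700107300180510048, 108800250624823, 108900200632371, 109000260097146, 178600109100090644600, 109200100650065, 109300180666564, 109400120676485, 109500100300950680038, 109600360693885, 106300109700230707124, 109900109800240712479, 110000110727900, 110200110100140730019, 110400110300130741925, 103300110500290752522],
[110600230762209, 110700900000103000440236820, 178600110800090772000, 110900180666542, 111100111000340784210, 101300111200270791066, 111300340116640, 111400120804085, 111500100300160810060, 111600250826059, 111700160835985, 111801810848532, 111900550853285, 112000240866606, 112100200591134, 112200130873476, 112300130887600, 112500112400140890024, 112600090902405, 112700100910506, 112800090580613, 112900210921341, 113200113100113000290930923, 113300240300007, 113400110940785, 113500250826036, 113600200953671, 113700240967124],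
[113800220972408, 113900101700440146134, 114000160873485, 114100150988555, 114300114200340995554, 114400210485485, 114600114505391008526, 114700861012685, 114900114800321026119, 115000110500290752528, 115100181032872, 115200171047200, 115300100650021, 115400130352111, 115500101051118, 115600151061819, 115700110300160741985, 105300105200900000178600271078535, 115800211082371, 115900141097106, 116000090580610, 116100105800401100021, 116200171112185, 116300114200340995530, 101300116400281123066, 116500321136611, 102000116600281141122, 116700350187328],
[116800211032885, 116900221158549, 117000201164971, 117100260097148, 117200280624885, 117310641178503, 117400111180320, 117700117601117501181192085, 117800220175609, 112600117900221200905, 118000180284122, 118100251212267, 178700118200221226700, 118300100300160810008, 118400151230825, 118500161242504, 112600118600211250405, 118700120580685, 101300118800291261066, 118900181276619, 106300110300130741924, 119000231281208, 119100221290885, 119200260097124, 119300211302408, 110400119400101700411316125, 119600119500251322528, 119700900000103000440236822],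
[119800281212285, 120000119900311338543, 101300120100281344366, 120200340116642, 100900111000370784285, 120600120517520400120317731358516, 120700161361607, 120800080940707, 120900080940732, 121000691373285, 121100102800281385023, 121200211082311, 121300250373509, 121400113000331390962, 121500281406285, 121600131418522, 121700241422213, 121900121800191431317, 122000191441711, 122200122100181451985, 122300109800240712408, 122500122400251466105, 122700122600301473822, 122900122800311482285, 123000340116611, 102000123100261491122, 123200261507306, 123300210921347],
[103300131514722, 123400240300009, 100900113000361390985, 123500171528571, 123600260097137, 123700211533708, 123800101700440146136, 123900061548569, 124100124000151556969, 124400124300124200211566981, 124500091578102, 124600181580221, 124700121592121, 124800141112126, 124901071602685, 125000161614110, 125100118800271621025, 125200107000321632923, 125300260097157, 116200125400381645785, 125500201658509, 115700113100102600341660985, 108100900000178600171678506, 125600090580603, 125100125700241680325, 125800100910503, 125900141180385, 102000111693422],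
[126000220175684, 126100111708418, 126200431713206, 126300090580609, 126400181720975, 100900231737585, 126500101700421746125, 126600231752528, 110200126700341766819, 126800105200900000178600271078541, 126900105800401100023, 101300127000251778566, 127100340116631, 102000127200271783122, 127300350187330, 127400101798564, 127500090676447, 127600131514764, 127700090676453, 127800091805370, 127900131817079, 128000110727915, 128100251821508, 128200171830808, 128300191290820, 128700128601328500128401461842085, 128900128800201853524, 129000151860813],
[129100241877110, 129200340116651, 129400105200900000129300281885108, 113200113100119900271898523, 129500110300130741916, 129600201901608, 129700151061816, 129800191361685, 129900102800300225082, 130000151918204, 110200130100741922619, 113200110300130741923, 130300130200271932371, 130400331947313, 103300130500311951322, 130700130600900000104100381966324, 130800180485435, 130900231281210, 131000181978508, 131100101700440146125, 131200221982528, 131300900000103000440236824, 131400150988559, 126800130835941, 131500180284159, 131600130835947, 131700131514765, 131800180666576],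
[131900151997601, 122700132000302000122, 132100232012222, 132200122800281482207, 132300080940740, 132400090804040, 132500090804058, 132600822025885, 132700132032901, 132800150330111, 133000132900242042285, 106300133100312056624, 133200101700440146145, 133300052064500, 133400132075422, 133500090580602, 102000133600252080222, 133700118600211250402, 133800232090285, 133900180284180, 121900134000192108017, 112500134200134101117501012112024, 134300190341008, 134400170130866, 115700134500900000103000442126885, 134700134600900000178600232138541, 134800110390030, 115400116400281123011],
[134900250624829, 106300122600301473824, 102000135000242148522, 135100350187313, 103300135200292151322, 135300240300011, 135400221158554, 135500250373554, 135600180485441, 135700180284160, 135800250826072, 136000135900192167214, 108100900000136100342171406, 136300136200322180909, 136400182197521, 136500141112134, 136600130873434, 136700130873452, 136801252205285, 136900172212314, 110400106200200451425, 137000142220901, 137100180330185, 137200101700342236106, 137300350187339, 137400072243900, 137500192254809, 137600110300130741915],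
[137700212261528, 137800101051115, 137900302271585, 138000250373577, 137200182287706, 138100080940756, 138300138200282295621, 102000106400262302422, 138400260162261, 138500152310006, 138600110390059, 105300130835935, 138700107300180510024, 138800111000340784223, 138900192328528, 139000900000103000452336885, 139100900000178600212348541, 139200105800401100025, 139300119900311338548, 139300107000340492948, 139400250624835, 139500250373555, 139600114200340995567, 139700182356706, 139800090580600, 104300104200900000100100212360000, 139900130200242372313, 113200121800191431323],
[140000241877108, 140100191290828, 140200181032828, 140300181032846, 140700140601540500140401692384685, 108000140800232391000, 141000140900202402314, 122200141100252411485, 110200141200232427319, 141300900000103000440236833, 178600141400092433300, 141500242444223, 141600090580601, 103300141700282450122, 141800161242501, 141900362460185, 142000107000340492973, 142100141112150, 142300142200262475034, 106500130873408, 142400102600350210956, 110200142500222480019, 142600107300180510054, 142700180666511, 142800260097110, 103300142900272498522, 143000252500085, 105300143100212510035],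
[143200231281213, 143300260097142, 143400111000340784229, 143500107000340492949, 143600260097162, 110200143700232526219, 143800110300130741900, 143900152530885, 122700133100312056622, 144000122800281482222, 144100251212222, 144200251212240, 144300090804064, 144400090676464, 144500090676478, 144600962547885, 144700220972479, 144800190341081, 108000091578100, 144900900000100100190570003, 145000232556824, 145100240300027, 145200122562785, 145400145300342573610, 136000110300130741914, 145500222581441, 136000121800191431314, 103100900000136100462591485],
[145600260097168, 145700191290844, 145800230274447, 115000131514728, 145900260097150, 112500146000252600024, 146100180666548, 146200232616025, 146300322626624, 146400900000178600202638541, 122200146600146500442640085, 146800146700142650054, 115700122600331473885, 146900340116636, 147000260097123, 147100260097143, 147200340116657, 147300232665724, 147400072670600, 147500232682285, 147600201737509, 147600113000331390909, 147700113000331390934, 147800130873459, 147900130835959, 148000130835974, 148400900000148302348200148101542697485, 112200116600302701176],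
[148500106400280462479, 148600110100140730016, 148700105200900000104100312716311, 148800105800420410021, 148900160352185, 139900116400252723013, 106300121800191431324, 105300105200900000100100292730035, 149000340116663, 149100122800281482238, 126800105200900000105100310363841, 149200340116644, 149300100300242740021, 149400250826042, 149500114200322755513, 149600101700422766111, 105300149700192770035, 149800480530009, 149900162780903, 150000100650070, 108700131817048, 150100101700440146130, 150200340116610, 150300340116637, 150400101700440146151, 148700105200900000129300312795111, 150500112801900, 150600302810985],
[150700240967123, 150800260097128, 150900181032854, 151000180485454, 151100180485469, 151301751200107501122826900, 151400022830000, 178600151500042840000, 148401000000552850085, 151600181032876, 133700090902402, 151700162865425, 151800250541208, 151900200130885, 152000101700440146158, 152100201737532, 152200101700440146138, 106500135000262878508, 152300114200340995536, 115700109700260707185, 110400152400322887325, 152500122890054, 152600100300950680023, 148600152700242902316, 152800100300160810065, 152900350187324, 153000101700421746124, 153100101700440146131],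
[153200350187345, 178700153300142910500, 153500153400103600422922385, 153600321136610, 153700340116622, 153800251212248, 153900250624848, 154000250624864, 154100091548585, 154200022938500, 154300042940000, 154400072950085, 154500251212272, 154600232964813, 154700312973822, 154800290162285, 154900350187352, 155000260097126, 155100350187332, 155200260097130, 108100900000103000352986806, 108700155300202990048, 155401810848510, 112500155500253001024, 155600150988560, 155700900000103000440236811, 155800331947311, 155900350187325],
[156000900000103000440236839, 156200156100203011885, 139900103022113, 156300253031385, 106300119400101700411316124, 156400101700440146109, 156500113000331390942, 156500111000340784242, 156600111000340784259, 156700131798585, 156800043048500, 156900083050000, 157000123060085, 139600113000331390967, 115700113100111000333074285, 157100503083209, 100900102600380210985, 157200900000103000440236846, 157300340116620, 157400900000103000440236826, 157500340116624, 157600100300123090065, 106300157705373108524, 138300109800240712421, 157800221158555, 157900223110025, 110400134500900000103000412126825, 158000900000103000440236813],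
[158100240300033, 158200113120405, 158300163130585, 103100900000178600293148585, 158400333157323, 158500260097136, 158600260097154, 158700180988585, 178700151200063168500, 178700141400158800123170000, 159000158900173180085, 113200159100803192623, 159200240300040, 159300101700440146107, 159400240300020, 159500101700440146111, 111500101798560, 159610641178506, 143500119900311338549, 159700105800403200013, 159800253110085, 159900105800420410027, 160000163211718, 160100233221885, 160200900000103000423236810, 160300340116630, 160400340116648, 160500251158585],
[160600060030027, 160700060030083, 160800183248385, 160900117601117501063252006, 161000105800420410034, 161100333157321, 161200105800420410007, 161300333157325, 161400120517520400120317731358519, 115700161500253261285, 161600105800433200085, 161700250541221, 161900161800223270304, 122900162000303280485, 106300162100213290024, 162200101700440146124, 162300101700440146142, 100900119900341338585, 162400100040021, 162500100040081, 162600233308185, 110200162700573313219, 162800250541228, 162900900000103000423236808, 163000233321221, 163100900000103000423236813, 163200091578105, 163300243333806],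
[122200163400273341285, 163500330693808, 163600201901679, 163700110727917, 163800191441775, 164000163900333350006, 164100350187311, 164200350187336, 164300150050008, 164400150050079, 164500293367985, 112500164600903372624, 164700330693822, 122700162100213290022, 164800313383808, 115700162100243290085, 164900110727918, 110200165000433393219, 165100243333803, 165200503403222, 112200133600273410276, 165300151997603, 130300125700263420371, 165400480530052, 110200165500163435219, 165600900000103000422336825, 165700900000103000440236830, 165800203440022],
[165900220060076, 166000373457685, 138300166200166101328500128401203462021, 166300520853209, 122700166400493473222, 166500151997604, 112500166600693482624, 148600165000433393216, 166700813492609, 129500135900192167216, 166800100300973500046, 112500166900153514624, 167000222500013, 167100240300024, 167200100800293520009, 167300100800310070072, 101800167400473537285, 167500090804068, 142300167600293546834, 167700813552623, 167800743562606, 121900135900192167217, 138300168000167901117500913572021, 113200168100117601117501123582023, 168201833598540, 138300090804021, 115700168300146500423600085, 168400105800420410011],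
[113200109700230707123, 168500260097167, 168600223616773, 168700130873463, 127500134600900000104100273626347, 168800117601117501133632010, 110200168900117601117501063642019, 169000080940720, 142300169100153652034, 169200573663206, 169305413678534, 169400162780906, 169500233321225, 169600340116662, 102900169700303686268, 169800181032858, 106300169900633693224, 112500170000523703224, 170100141112107, 170200080940747, 110200170300953712619, 170410763728528, 110200152700242902319, 170500313383813, 170600101700440146157, 170700232665741, 170800251212252, 170900953732606],
[138300171000813742621, 171100173750821, 171200141112141, 112500171300128601328500128401293762024, 171500171417520400120317893778522, 115700166400523473285, 171600350187351, 105300105200900000129300312795135, 171700113000331390946, 110200171800128601328500128401343782019, 142300172000171901328500128401093792034, 172100122800263802208, 172200191290835, 138300172300563815821, 172400124300124200211566967, 172500283826709, 172600900000103000440236845, 172700260097140, 112500172800653835824, 172900090804046, 127500173000153844647, 122700113100163857522, 173100122800281482229, 142300173200893865234, 173300131817062, 173400333876223, 173500240300039, 173600340116634],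
[138300173700993885221, 173800130873440, 173900090804059, 138800201737523, 127500174100174001540500140401213894647, 174200180666557, 160200900000174300423905710, 174400105800420410033, 174500101700440146128, 142300174700900000174600140601540500140401333914634, 174800181032834, 174900130873454, 175000090676469, 175200175100153926959, 175300250826051, 104300104200900000129300233935100, 175400250541227, 175500350187322, 104300053947800, 127500175600173950047, 175700251212228, 175800181032848, 175900130835964, 176000090676470, 142600131817054, 176100114200340995545, 176200330693821, 176300900000103000440236809],
[175200146700142650059, 176400113000331390922, 176500251212242, 176600180485459, 176700130835965, 176800260097139, 176900520853208, 177000223110023, 177100260097109, 152300113000331390936, 177200250624854, 177300180485460, 177400340116633, 177500813552622, 177600105800403200010, 177700322626623, 139300111000340784248, 177800250624855, 177900101700440146127, 178000117601117501133632009, 106300161500223261224, 178100101700422766110, 143500111000340784249, 178200350187321, 113200169900633693223, 106300152400322887324, 178300900000103000440236808, 178400223110022],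
[178500105800403200009, 113200161500223261223, 178600003968500, 178700003978500, 0, 0, 0, 0, 0, 0, 0, 0, 0, 0, 0, 0, 0, 0, 0, 0, 0, 0, 0, 0, 0, 0, 0, 0]]

@[irreducible] def ctT : List ℕ := [0, 140, 150, 160, 170, 180, 190, 210, 220, 230, 240, 250, 380, 850, 2, 12, 22, 32, 42, 52, 72, 82, 92, 102, 112, 132, 202, 212, 222, 232, 242, 252, 262, 272, 282, 292, 302, 312, 322, 332, 342, 352, 362, 372, 382, 392, 402, 412, 422, 432, 442, 452, 462, 472, 482, 492, 502, 512, 522, 542, 552, 562, 572, 582, 592, 602, 612, 622, 632, 642, 652, 662, 672, 682, 692, 712, 722, 732, 742, 762, 772, 792, 802, 812, 822, 852]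


def getL {α : Type} (d : α) (l : List α) : ℕ → α :=
  List.rec (motive := fun _ => ℕ → α) (fun _ => d)
    (fun a _ ih i => Nat.rec (motive := fun _ => α) a (fun j _ => ih j) i) l

def get2 (t : List (List ℕ)) (i : ℕ) : ℕ := getL 0 (getL [] t (i / 28)) (i % 28)

def decS (f : ℕ) : ℕ → List ℕ :=
  Nat.rec (motive := fun _ => ℕ → List ℕ) (fun _ => [])
    (fun _ ih m => bif Nat.ble 10 m then Nat.mod m 10 :: ih (Nat.div m 10) else []) f

def outD (f : ℕ) : ℕ → List ℕ :=
  Nat.rec (motive := fun _ => ℕ → List ℕ) (fun _ => [])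
    (fun _ ih m => bif Nat.ble 1 m then
      List.replicate (m / 1000 % 1000) (m % 1000) ++ ih (Nat.div m 1000000) else []) f

def rowN (s : ℕ) : ℕ := get2 rowT s
def ctxN (s : ℕ) : ℕ := rowN s % 100
def clsN (s : ℕ) : ℕ := rowN s / 100 % 100
def strN (s : ℕ) : List ℕ := decS 2000 (get2 molT (rowN s / 10000 % 1000))
def gN (s : ℕ) : ℕ := rowN s / 10000000 % 10000
def outN (s : ℕ) : List ℕ := outD 12 (rowN s / 100000000000)
def kN (c : ℕ) : ℕ := getL 0 ctT c % 10
def nxN (c : ℕ) : ℕ := getL 0 ctT c / 10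
def phiN (c : ℕ) : ℕ := bif Nat.beq c 85 then 3 else 0

def beqL (l : List ℕ) : List ℕ → Bool :=
  List.rec (motive := fun _ => List ℕ → Bool)
    (fun m => List.rec (motive := fun _ => Bool) true (fun _ _ _ => false) m)
    (fun a _ ih m => List.rec (motive := fun _ => Bool) false
      (fun b t _ => bif Nat.beq a b then ih t else false) m) l

theorem beqL_eq (l : List ℕ) : ∀ m, beqL l m = true → l = m := by
  induction l with
  | nil => intro m h; cases m with
    | nil => rfl
    | cons a t => exact absurd h (by simp [beqL])
  | cons a l ih => intro m h; cases m with
    | nil => exact absurd h (by simp [beqL])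
    | cons b t =>
      change (bif Nat.beq a b then beqL l t else false) = true at h
      by_cases hab : a = b
      · subst hab
        simp only [Nat.beq_refl, cond_true] at h
        rw [ih t h]
      · rw [beq_ff hab] at h; simp at h

/-- `2` or `0` test -/
def is02 (d : ℕ) : Bool := bif Nat.beq d 0 then true else Nat.beq d 2

theorem is02_iff (d : ℕ) : is02 d = true ↔ d = 0 ∨ d = 2 := by
  unfold is02
  by_cases h : d = 0
  · simp [h]
  · rw [beq_ff h]; simp [h]

def headOK (l : List ℕ) : Bool :=
  List.rec (motive := fun _ => Bool) false (fun a _ _ => bif is02 a then false else true) l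
/-- last element of `d :: l` is 0 or 2 -/
def lastA (l : List ℕ) : ℕ → Bool :=
  List.rec (motive := fun _ => ℕ → Bool) (fun d => is02 d) (fun a _ ih _ => ih a) l
def lastOK (l : List ℕ) : Bool :=
  List.rec (motive := fun _ => Bool) false (fun a t _ => lastA t a) l

def okW (w : List ℕ) : ℕ → ℕ → Bool :=
  List.rec (motive := fun _ => ℕ → ℕ → Bool) (fun c c' => Nat.beq c c')
    (fun s _ ih c c' => bif Nat.beq (clsN s) c then
      (bif Nat.ble 788 s then false else ih (ctxN s) c') else false) w

def strW (w : List ℕ) : List ℕ :=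
  List.rec (motive := fun _ => List ℕ) [] (fun s _ ih => strN s ++ ih) w

def twos (k : ℕ) : List ℕ := List.replicate k 2

def lenL (l : List ℕ) : ℕ → ℕ :=
  List.rec (motive := fun _ => ℕ → ℕ) (fun n => n) (fun _ _ ih n => ih n.succ) l

def chkS (s : ℕ) : Bool :=
  bif beqL (sayN (strN s) ++ twos (kN (ctxN s))) (twos (kN (clsN s)) ++ strW (outN s)) then
  bif headOK (strN s) then
  bif lastOK (strN s) then
  bif okW (outN s) (nxN (clsN s)) (nxN (ctxN s)) then
    Nat.beq (lenL (strN s) (phiN (ctxN s))) (gN s + phiN (clsN s))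
  else false else false else false else false

def allN (p : ℕ → Bool) (n : ℕ) : Bool :=
  Nat.rec (motive := fun _ => Bool) true (fun i b => bif p i then b else false) n

theorem allN_spec (p : ℕ → Bool) (n : ℕ) (h : allN p n = true) : ∀ i < n, p i = true := by
  induction n with
  | zero => intro i hi; omega
  | succ n ih =>
    change (bif p n then allN p n else false) = true at h
    intro i hi
    cases hp : p n with
    | false => rw [hp] at h; simp at h
    | true =>
      rw [hp] at h
      rcases Nat.lt_succ_iff_lt_or_eq.1 hi with h1 | h1
      · exact ih h i h1
      · rw [h1, hp]

theorem chkS_all : allN chkS 788 = true := by decide +kernel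

theorem cond_and {a b : Bool} (h : (bif a then b else false) = true) : a = true ∧ b = true := by
  cases a <;> simp_all

theorem lastA_spec (l : List ℕ) : ∀ d, lastA l d = true →
    ((d :: l).getLast (by simp) = 0 ∨ (d :: l).getLast (by simp) = 2) := by
  induction l with
  | nil => intro d h; simpa using (is02_iff d).1 h
  | cons a l ih =>
    intro d h
    rw [List.getLast_cons (by simp)]
    exact ih a h

theorem lastOK_spec (l : List ℕ) (h : lastOK l = true) :
    ∃ hl : l ≠ [], (l.getLast hl = 0 ∨ l.getLast hl = 2) := by
  cases l with
  | nil => simp [lastOK] at h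
  | cons a t => exact ⟨by simp, lastA_spec t a h⟩

theorem headOK_spec (l : List ℕ) (h : headOK l = true) :
    ∃ a t, l = a :: t ∧ a ≠ 0 ∧ a ≠ 2 := by
  cases l with
  | nil => simp [headOK] at h
  | cons a t =>
    refine ⟨a, t, rfl, ?_⟩
    change (bif is02 a then false else true) = true at h
    have : ¬ (a = 0 ∨ a = 2) := by rw [← is02_iff]; intro q; rw [q] at h; simp at h
    tauto

theorem lenL_eq (l : List ℕ) : ∀ n, lenL l n = l.length + n := by
  induction l with
  | nil => intro n; simp [lenL]
  | cons a l ih =>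
    intro n
    change lenL l n.succ = _
    rw [ih]; simp; omega

theorem chkS_spec (s : ℕ) (hs : s < 788) :
    (sayN (strN s) ++ twos (kN (ctxN s)) = twos (kN (clsN s)) ++ strW (outN s)) ∧
    headOK (strN s) = true ∧ lastOK (strN s) = true ∧
    okW (outN s) (nxN (clsN s)) (nxN (ctxN s)) = true ∧
    (strN s).length + phiN (ctxN s) = gN s + phiN (clsN s) := by
  have h := allN_spec _ _ chkS_all s hs
  unfold chkS at h
  obtain ⟨h1, h⟩ := cond_and h
  obtain ⟨h2, h⟩ := cond_and h
  obtain ⟨h3, h⟩ := cond_and h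
  obtain ⟨h4, h⟩ := cond_and h
  refine ⟨beqL_eq _ _ h1, h2, h3, h4, ?_⟩
  rw [Nat.beq_eq, lenL_eq] at h
  exact h

theorem okW_nil (c c' : ℕ) : okW [] c c' = true ↔ c = c' := by
  change Nat.beq c c' = true ↔ _
  rw [Nat.beq_eq]

theorem okW_cons (s : ℕ) (w : List ℕ) (c c' : ℕ) :
    okW (s :: w) c c' = true ↔ clsN s = c ∧ s < 788 ∧ okW w (ctxN s) c' = true := by
  change (bif Nat.beq (clsN s) c then
      (bif Nat.ble 788 s then false else okW w (ctxN s) c') else false) = true ↔ _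
  by_cases h1 : clsN s = c
  · rw [h1, Nat.beq_refl]
    by_cases h2 : 788 ≤ s
    · rw [ble_tt h2]; simp; omega
    · rw [ble_ff h2]; simp; omega
  · rw [beq_ff h1]; simp [h1]

theorem okW_append (v w : List ℕ) : ∀ c c' c'', okW v c c' = true → okW w c' c'' = true →
    okW (v ++ w) c c'' = true := by
  induction v with
  | nil => intro c c' c'' h1 h2; rw [okW_nil] at h1; subst h1; exact h2
  | cons s v ih =>
    intro c c' c'' h1 h2
    rw [okW_cons] at h1
    rw [List.cons_append, okW_cons]
    exact ⟨h1.1, h1.2.1, ih _ _ _ h1.2.2 h2⟩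

theorem strW_cons (s : ℕ) (w : List ℕ) : strW (s :: w) = strN s ++ strW w := rfl
theorem strW_append (v w : List ℕ) : strW (v ++ w) = strW v ++ strW w := by
  induction v with
  | nil => rfl
  | cons s v ih => rw [List.cons_append, strW_cons, strW_cons, ih, List.append_assoc]

theorem word_ok (w : List ℕ) : ∀ c c', okW w c c' = true →
    okW (w.flatMap outN) (nxN c) (nxN c') = true := by
  induction w with
  | nil => intro c c' h; rw [okW_nil] at h; subst h; exact (okW_nil _ _).2 rfl
  | cons s w ih =>
    intro c c' h
    rw [okW_cons] at h
    obtain ⟨h1, h2, h3⟩ := h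
    rw [List.flatMap_cons]
    subst h1
    exact okW_append _ _ _ _ _ (chkS_spec s h2).2.2.2.1 (ih _ _ h3)

theorem word_say (w : List ℕ) : ∀ c c', okW w c c' = true →
    sayN (strW w) ++ twos (kN c') = twos (kN c) ++ strW (w.flatMap outN) := by
  induction w with
  | nil =>
    intro c c' h; rw [okW_nil] at h; subst h
    simp [strW, sayN]
  | cons s w ih =>
    intro c c' h
    rw [okW_cons] at h
    obtain ⟨h1, h2, h3⟩ := h
    obtain ⟨e, -, hl, -, -⟩ := chkS_spec s h2
    obtain ⟨hne, hl⟩ := lastOK_spec _ hl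
    rw [strW_cons, sayN_append _ _ hne, List.append_assoc, ih _ _ h3, ← List.append_assoc, e, h1,
      List.flatMap_cons, strW_append, List.append_assoc]
    intro b hb
    cases w with
    | nil => simp [strW] at hb
    | cons t w =>
      rw [okW_cons] at h3
      obtain ⟨a, l, ha, ha1, ha2⟩ := headOK_spec _ (chkS_spec t h3.2.1).2.1
      rw [strW_cons, ha] at hb
      simp at hb
      subst hb
      rcases hl with hl | hl <;> rw [hl] <;> [exact ha1.symm; exact ha2.symm]

theorem word_len (w : List ℕ) : ∀ c c', okW w c c' = true →
    (strW w).length + phiN c' = (w.map gN).sum + phiN c := by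
  induction w with
  | nil => intro c c' h; rw [okW_nil] at h; subst h; simp [strW]
  | cons s w ih =>
    intro c c' h
    rw [okW_cons] at h
    obtain ⟨h1, h2, h3⟩ := h
    have := (chkS_spec s h2).2.2.2.2
    have := ih _ _ h3
    rw [strW_cons, List.length_append, List.map_cons, List.sum_cons]
    subst h1
    omega

def wordN (n : ℕ) : List ℕ := (fun w => w.flatMap outN)^[n] [0]

theorem word0 : okW [0] 0 0 = true ∧ strW [0] = [1, 0] ∧ nxN 0 = 0 ∧ kN 0 = 0 := by
  decide +kernel

theorem wordN_ok (n : ℕ) : okW (wordN n) 0 0 = true := by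
  induction n with
  | zero => exact word0.1
  | succ n ih =>
    have := word_ok _ _ _ ih
    rw [word0.2.2.1] at this
    rw [wordN, Function.iterate_succ_apply']
    exact this

theorem wordN_str (n : ℕ) : sayN^[n+1] [0] = strW (wordN n) := by
  induction n with
  | zero => rw [wordN, Function.iterate_zero, id, word0.2.1]; decide +kernel
  | succ n ih =>
    rw [Function.iterate_succ_apply', ih]
    have := word_say _ _ _ (wordN_ok n)
    rw [word0.2.2.2] at this
    simp only [twos, List.replicate_zero, List.append_nil, List.nil_append] at this
    rw [this, wordN, wordN, Function.iterate_succ_apply']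

/-- the weights after `n` steps -/
def uN (n : ℕ) (s : ℕ) : ℕ :=
  Nat.rec (motive := fun _ => ℕ → ℕ) gN (fun _ u s => ((outN s).map u).sum) n s

theorem uN_zero (s : ℕ) : uN 0 s = gN s := rfl
theorem uN_succ (n s : ℕ) : uN (n + 1) s = ((outN s).map (uN n)).sum := rfl

theorem uN_word (n : ℕ) : ∀ w : List ℕ,
    (((fun w => w.flatMap outN)^[n] w).map gN).sum = (w.map (uN n)).sum := by
  induction n with
  | zero => intro w; rfl
  | succ n ih =>
    intro w
    rw [Function.iterate_succ_apply, ih]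
    induction w with
    | nil => rfl
    | cons s w ihw =>
      rw [List.flatMap_cons, List.map_append, List.sum_append, List.map_cons, List.sum_cons, ihw,
        uN_succ]

theorem len_eq (n : ℕ) : (say^[n + 1] ([0] : List (Fin 10))).length = uN n 0 := by
  have h1 : (say^[n + 1] ([0] : List (Fin 10))).length =
      ((say^[n + 1] ([0] : List (Fin 10))).map Fin.val).length := by simp
  rw [h1, iter_val]
  change (sayN^[n+1] [0]).length = _
  rw [wordN_str]
  have := word_len _ _ _ (wordN_ok n)
  have h2 := uN_word n [0]
  rw [wordN] at *
  rw [h2] at this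
  simpa using this

/-! ## Part B: convergence of ratios -/

theorem outN_lt (s : ℕ) (hs : s < 788) : ∀ t ∈ outN s, t < 788 := by
  have h := (chkS_spec s hs).2.2.2.1
  generalize outN s = w at h
  generalize nxN (clsN s) = c at h
  generalize nxN (ctxN s) = c' at h
  induction w generalizing c with
  | nil => simp
  | cons x w ih =>
    rw [okW_cons] at h
    intro t ht
    rcases List.mem_cons.1 ht with h1 | h1
    · rw [h1]; exact h.2.1
    · exact ih _ h.2.2 t h1

noncomputable def TR (f : ℕ → ℝ) (s : ℕ) : ℝ := ((outN s).map f).sum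

noncomputable def uR (n s : ℕ) : ℝ := (uN n s : ℝ)

theorem uR_succ (n : ℕ) : uR (n + 1) = TR (uR n) := by
  funext s
  simp only [uR, TR, uN_succ]
  induction outN s with
  | nil => simp
  | cons a l ih => simp [ih, uR]

theorem sum_mono_list (l : List ℕ) (f g : ℕ → ℝ) (h : ∀ t ∈ l, f t ≤ g t) :
    (l.map f).sum ≤ (l.map g).sum := List.sum_le_sum h

theorem TR_mono {f g : ℕ → ℝ} (h : ∀ t < 788, f t ≤ g t) : ∀ s < 788, TR f s ≤ TR g s :=
  fun s hs => sum_mono_list _ _ _ fun t ht => h t (outN_lt s hs t ht)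

theorem TR_lin (a b : ℝ) (f g : ℕ → ℝ) :
    TR (fun t => a * f t + b * g t) = fun s => a * TR f s + b * TR g s := by
  funext s
  simp only [TR]
  induction outN s with
  | nil => simp
  | cons x l ih => simp [ih]; ring

theorem TRi_mono (K : ℕ) : ∀ {f g : ℕ → ℝ}, (∀ t < 788, f t ≤ g t) →
    ∀ s < 788, TR^[K] f s ≤ TR^[K] g s := by
  induction K with
  | zero => intro f g h; exact h
  | succ K ih =>
    intro f g h
    rw [Function.iterate_succ_apply, Function.iterate_succ_apply]
    exact ih (TR_mono h)

theorem TRi_lin (K : ℕ) : ∀ (a b : ℝ) (f g : ℕ → ℝ),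
    TR^[K] (fun t => a * f t + b * g t) = fun s => a * TR^[K] f s + b * TR^[K] g s := by
  induction K with
  | zero => intro a b f g; rfl
  | succ K ih =>
    intro a b f g
    rw [Function.iterate_succ_apply, TR_lin, ih]
    rfl

theorem TRi_u (K n : ℕ) : TR^[K] (uR n) = uR (n + K) := by
  induction K with
  | zero => rfl
  | succ K ih => rw [Function.iterate_succ_apply', ih, ← uR_succ]; rfl

def PW (n : ℕ) (a b : ℝ) : Prop :=
  ∀ i < 788, a * uR n i ≤ uR (n + 1) i ∧ uR (n + 1) i ≤ b * uR n i

theorem PW_succ {n : ℕ} {a b : ℝ} (h : PW n a b) (K : ℕ) : PW (n + K) a b := by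
  intro i hi
  have h1 := TRi_mono K (f := fun t => a * uR n t + 0 * uR n t) (g := uR (n + 1))
    (fun t ht => by simpa using (h t ht).1) i hi
  have h2 := TRi_mono K (f := uR (n + 1)) (g := fun t => b * uR n t + 0 * uR n t)
    (fun t ht => by simpa using (h t ht).2) i hi
  rw [TRi_lin, TRi_u, TRi_u] at h1 h2
  have e : n + K + 1 = n + 1 + K := by omega
  rw [e]
  simp only [zero_mul, add_zero] at h1 h2
  exact ⟨h1, h2⟩

theorem uR_nonneg (n i : ℕ) : 0 ≤ uR n i := Nat.cast_nonneg _

def bfsF (c : ℕ) (l : List ℕ) : ℕ :=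
  List.rec (motive := fun _ => ℕ → ℕ) (fun c => c)
    (fun t _ ih c => bif Nat.beq t c then forceN c.succ ih else ih c) l c

def bfsL (f : ℕ) : ℕ → ℕ → ℕ :=
  Nat.rec (motive := fun _ => ℕ → ℕ → ℕ) (fun _ c => c)
    (fun _ ih p c => bif Nat.ble c p then c else
      forceN (bfsF c (outN p)) (fun c' => forceN p.succ (fun p' => ih p' c'))) f

def sumOut (l : List ℕ) : ℕ :=
  List.rec (motive := fun _ => ℕ) 0 (fun t _ ih => gN t + ih) l

theorem sumOut_eq (l : List ℕ) : sumOut l = (l.map gN).sum := by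
  induction l with
  | nil => rfl
  | cons a l ih => rw [List.map_cons, List.sum_cons, ← ih]; rfl

theorem chkB : allN (fun s => Nat.ble (sumOut (outN s)) (3 * gN s)) 788 = true ∧
    bfsL 788 0 1 = 786 ∧
    beqL (outN 786) [786] = true ∧ beqL (outN 787) [787] = true ∧ gN 786 = 0 ∧ gN 787 = 0 := by
  decide +kernel

theorem PW3 (n : ℕ) : PW n 0 3 := by
  have : PW 0 0 3 := by
    intro i hi
    refine ⟨by simpa using uR_nonneg 1 i, ?_⟩
    have h := allN_spec _ _ chkB.1 i hi
    rw [Nat.ble_eq, sumOut_eq] at h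
    have h' : uN 1 i ≤ 3 * uN 0 i := h
    simp only [uR]
    exact_mod_cast h'
  simpa using PW_succ this n

theorem special (n i : ℕ) (h : 786 ≤ i) (hi : i < 788) : uR n i = 0 := by
  have h6 := beqL_eq _ _ chkB.2.2.1
  have h7 := beqL_eq _ _ chkB.2.2.2.1
  have e : i = 786 ∨ i = 787 := by omega
  have : uN n i = 0 := by
    induction n with
    | zero => rcases e with e | e <;> subst e <;> [exact chkB.2.2.2.2.1; exact chkB.2.2.2.2.2]
    | succ n ih => rcases e with e | e <;> subst e <;> simp [uN_succ, h6, h7, ih]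
  simp [uR, this]

def Dom (i : ℕ) : Prop := ∀ n, uR n i ≤ (3 : ℝ) ^ i * uR n 0

theorem mem_le (n s t : ℕ) (h : t ∈ outN s) : uR n t ≤ uR (n + 1) s := by
  have : uN n t ≤ uN (n + 1) s := by
    rw [uN_succ]
    exact List.le_sum_of_mem (List.mem_map_of_mem h)
  simp only [uR]
  exact_mod_cast this

theorem Dom_step (p i : ℕ) (hp : p < i) (hp2 : p < 788) (h : Dom p) (hm : i ∈ outN p) : Dom i := by
  intro n
  have h1 := mem_le n p i hm
  have h2 := (PW3 n p hp2).2
  have h3 := h n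
  have h4 : (3 : ℝ) ^ (p + 1) ≤ 3 ^ i := pow_le_pow_right₀ (by norm_num) hp
  have h5 := uR_nonneg n 0
  calc uR n i ≤ 3 * ((3 : ℝ) ^ p * uR n 0) := by linarith
    _ = 3 ^ (p + 1) * uR n 0 := by ring
    _ ≤ _ := by gcongr

theorem bfsF_spec (p : ℕ) (hp2 : p < 788) (l : List ℕ) : ∀ c, (∀ t ∈ l, t ∈ outN p) → p < c →
    (∀ i < c, Dom i) → ∀ i < bfsF c l, Dom i := by
  induction l with
  | nil => intro c _ _ h; exact h
  | cons t l ih =>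
    intro c hm hpc h
    change ∀ i < (bif Nat.beq t c then forceN c.succ (fun c => bfsF c l) else bfsF c l), Dom i
    rw [forceN_eq]
    by_cases e : t = c
    · subst e
      rw [Nat.beq_refl]
      refine ih _ (fun x hx => hm x (List.mem_cons_of_mem _ hx)) (by omega) ?_
      intro i hi
      rcases Nat.lt_succ_iff_lt_or_eq.1 hi with h1 | h1
      · exact h i h1
      · rw [h1]
        exact Dom_step p t hpc hp2 (h p hpc) (hm t (by simp))
    · rw [beq_ff e]
      exact ih _ (fun x hx => hm x (List.mem_cons_of_mem _ hx)) hpc h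

theorem bfsL_spec (f : ℕ) : ∀ p c, p + f ≤ 788 → (∀ i < c, Dom i) → ∀ i < bfsL f p c, Dom i := by
  induction f with
  | zero => intro p c _ h; exact h
  | succ f ih =>
    intro p c hp h
    change ∀ i < (bif Nat.ble c p then c else
      forceN (bfsF c (outN p)) (fun c' => forceN p.succ (fun p' => bfsL f p' c'))), Dom i
    rw [forceN_eq, forceN_eq]
    by_cases e : c ≤ p
    · rw [ble_tt e]; exact h
    · rw [ble_ff e]
      exact ih _ _ (by omega) (bfsF_spec p (by omega) _ c (fun t ht => ht) (by omega) h)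

theorem dom_all (n i : ℕ) (hi : i < 788) : uR n i ≤ (3 : ℝ) ^ 786 * uR n 0 := by
  by_cases h : 786 ≤ i
  · rw [special n i h hi]
    exact mul_nonneg (by positivity) (uR_nonneg _ _)
  · have h1 := bfsL_spec 788 0 1 (by norm_num) (by
      intro i hi n
      have : i = 0 := by omega
      subst this; simp) i (by rw [chkB.2.1]; omega) n
    have h4 : (3 : ℝ) ^ i ≤ 3 ^ 786 := pow_le_pow_right₀ (by norm_num) (by omega)
    have h5 := uR_nonneg n 0
    exact h1.trans (by gcongr)

noncomputable def e0 (t : ℕ) : ℝ := if t = 0 then 1 else 0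

theorem grow (n K : ℕ) : uR (n + K) 0 ≤ 3 ^ K * uR n 0 := by
  induction K with
  | zero => simp
  | succ K ih =>
    have := (PW3 (n + K) 0 (by norm_num)).2
    rw [pow_succ]
    rw [← add_assoc]; linarith

theorem contract (K n : ℕ) (hK : ∀ i < 786, 1 ≤ TR^[K] e0 i) (a b : ℝ) (h : PW n a b)
    (hpos : 0 < uR n 0) (δ : ℝ) (hδ0 : 0 ≤ δ) (hδ : δ * (3 ^ 786 * 3 ^ K) ≤ 1) :
    ∃ a' b', a ≤ a' ∧ b' ≤ b ∧ b' - a' = (1 - δ) * (b - a) ∧ PW (n + K) a' b' := by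
  set r : ℝ := uR (n + 1) 0 / uR n 0 with hr
  have hr' : uR (n + 1) 0 = r * uR n 0 := by rw [hr]; field_simp
  have ha : a ≤ r := by rw [hr, le_div_iff₀ hpos]; exact (h 0 (by norm_num)).1
  have hb : r ≤ b := by rw [hr, div_le_iff₀ hpos]; exact (h 0 (by norm_num)).2
  have hup : ∀ i < 788, δ * uR (n + K) i ≤ uR n 0 := by
    intro i hi
    have h1 := dom_all (n + K) i hi
    have h2 := grow n K
    calc δ * uR (n + K) i ≤ δ * ((3 : ℝ) ^ 786 * (3 ^ K * uR n 0)) := by gcongr; exact h1.trans (by gcongr)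
      _ = δ * (3 ^ 786 * 3 ^ K) * uR n 0 := by ring
      _ ≤ 1 * uR n 0 := by gcongr
      _ = _ := one_mul _
  have key : ∀ (x y : ℝ), (∀ i < 788, 0 ≤ x * uR (n + 1) i + y * uR n i) → ∀ i < 786,
      x * uR (n + 1) 0 + y * uR n 0 ≤ x * uR (n + K + 1) i + y * uR (n + K) i := by
    intro x y hxy i hi
    set v0 := x * uR (n + 1) 0 + y * uR n 0 with hv0
    have hv : 0 ≤ v0 := hxy 0 (by norm_num)
    have h1 := TRi_mono K (f := fun t => v0 * e0 t + 0 * e0 t)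
      (g := fun t => x * uR (n + 1) t + y * uR n t) (by
        intro t ht
        by_cases e : t = 0
        · subst e; simp [e0, hv0]
        · simp [e0, e]; exact hxy t ht) i (by omega)
    rw [TRi_lin, TRi_lin, TRi_u, TRi_u] at h1
    have e : n + K + 1 = n + 1 + K := by omega
    rw [e]
    have h2 := hK i hi
    simp only [zero_mul, add_zero] at h1
    nlinarith
  refine ⟨a + δ * (r - a), b - δ * (b - r), by nlinarith, by nlinarith, by ring, ?_⟩
  intro i hi
  by_cases h6 : 786 ≤ i
  · rw [special _ i h6 hi, special _ i h6 hi]; simp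
  · have hh := hup i hi
    constructor
    · have := key 1 (-a) (fun j hj => by have := (h j hj).1; linarith) i (by omega)
      rw [hr'] at this
      have h7 : (r - a) * (δ * uR (n + K) i) ≤ (r - a) * uR n 0 :=
        mul_le_mul_of_nonneg_left hh (by linarith)
      nlinarith
    · have := key (-1) b (fun j hj => by have := (h j hj).2; linarith) i (by omega)
      rw [hr'] at this
      have h7 : (b - r) * (δ * uR (n + K) i) ≤ (b - r) * uR n 0 :=
        mul_le_mul_of_nonneg_left hh (by linarith)
      nlinarith

theorem conv (K N : ℕ) (hK : ∀ i < 786, 1 ≤ TR^[K] e0 i) (a b : ℝ) (ha0 : 0 < a)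
    (h : PW N a b) (hpos : 0 < uR N 0) :
    ∃ lam : ℝ, a ≤ lam ∧ lam ≤ b ∧ (∀ n, 0 < uR (N + n) 0) ∧
      Filter.Tendsto (fun n => uR (n + 1) 0 / uR n 0) Filter.atTop (nhds lam) := by
  have hp : ∀ n, 0 < uR (N + n) 0 := by
    intro n
    induction n with
    | zero => exact hpos
    | succ n ih =>
      have := (PW_succ h n 0 (by norm_num)).1
      exact lt_of_lt_of_le (mul_pos ha0 ih) this
  have hint : ∀ n a b, PW (N + n) a b → a ≤ uR (N + n + 1) 0 / uR (N + n) 0 ∧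
      uR (N + n + 1) 0 / uR (N + n) 0 ≤ b := by
    intro n a b h
    have := h 0 (by norm_num)
    rw [le_div_iff₀ (hp n), div_le_iff₀ (hp n)]
    exact this
  set δ : ℝ := ((3 : ℝ) ^ 786 * 3 ^ K)⁻¹ with hδ
  have hδ0 : 0 < δ := by rw [hδ]; positivity
  have hδ1 : δ ≤ 1 := by
    rw [hδ]; apply inv_le_one_of_one_le₀
    exact one_le_mul_of_one_le_of_one_le (one_le_pow₀ (by norm_num)) (one_le_pow₀ (by norm_num))
  have hseq : ∀ j : ℕ, ∃ a' b', b' - a' = (1 - δ) ^ j * (b - a) ∧ PW (N + j * K) a' b' := by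
    intro j
    induction j with
    | zero => exact ⟨a, b, by simp, by simpa using h⟩
    | succ j ih =>
      obtain ⟨a1, b1, e1, h1⟩ := ih
      obtain ⟨a2, b2, -, -, e2, h2⟩ := contract K _ hK a1 b1 h1 (hp _) δ hδ0.le
        (by rw [hδ]; exact (inv_mul_cancel₀ (by positivity)).le)
      refine ⟨a2, b2, by rw [e2, e1]; ring, ?_⟩
      have : N + (j + 1) * K = N + j * K + K := by ring
      rw [this]; exact h2
  set r : ℕ → ℝ := fun n => uR (N + n + 1) 0 / uR (N + n) 0 with hr
  have hc : CauchySeq r := by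
    rw [Metric.cauchySeq_iff']
    intro ε hε
    have ht : Filter.Tendsto (fun j : ℕ => (1 - δ) ^ j * (b - a)) Filter.atTop (nhds (0 * (b - a))) :=
      (tendsto_pow_atTop_nhds_zero_of_lt_one (by linarith) (by linarith)).mul_const _
    rw [zero_mul] at ht
    obtain ⟨j, hj⟩ := (ht.eventually (gt_mem_nhds hε)).exists
    obtain ⟨a1, b1, e1, h1⟩ := hseq j
    refine ⟨j * K, fun n hn => ?_⟩
    have h2 := hint _ _ _ h1
    have h3 : PW (N + n) a1 b1 := by
      have := PW_succ h1 (n - j * K)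
      have e : N + j * K + (n - j * K) = N + n := by omega
      rwa [e] at this
    have h4 := hint _ _ _ h3
    rw [Real.dist_eq, abs_lt]
    simp only [hr]
    constructor <;> linarith [h2.1, h2.2, h4.1, h4.2]
  obtain ⟨lam, hl⟩ := cauchySeq_tendsto_of_complete hc
  refine ⟨lam, ?_, ?_, hp, ?_⟩
  · exact ge_of_tendsto' hl fun n => (hint _ _ _ (PW_succ h n)).1
  · exact le_of_tendsto' hl fun n => (hint _ _ _ (PW_succ h n)).2
  · rw [← Filter.tendsto_add_atTop_iff_nat N]
    refine hl.congr fun n => ?_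
    simp only [hr]
    rw [add_comm N n]

@[irreducible] def fT : List ℕ := [9999999999989, 9999999999593, 9999999993719, 9999999920085, 9999999288949, 9999998480020, 10000007817292, 9999988739569, 10000010506178, 9999979402611, 10000052316396, 9999920483669,
10000052238285, 9999997097796, 9999848168330, 10000436526589, 9999423036816, 10000694596945, 9998443081896, 10002464733477, 9997809382369, 10000762053872, 10000600047358, 9998376754488,
10003901846285, 9995022309570, 10005277989565, 9994019062593, 10003329800195, 10001286441086, 9994185201266, 10010226428347, 9986059602393, 10009849902838, 10005986199951, 9977723720554,
10019275484678, 9985028303888, 10042389805588, 9941658282470, 10035942236335, 9972240326842, 10053707706055, 9953264668111, 10001116589673, 10033012502618, 9945886470742, 10051363804233,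
9953096400111, 9983168834651, 10127779547325, 9892696732707, 10082138577114, 9768835889142, 10284882780202, 9796075285802, 10253927446808, 9713917449211, 10198633867855, 9858826572015,
10126942751272, 9867279046399, 10044246019876, 10149717463671, 9741698732862, 10239226529191, 9691737286102, 10238082470425, 9969460275446, 10281912848387, 9771069487435, 9820057814499,
10047965613456, 9984671764954, 10160630993291, 10068527486502, 9807100689091, 10144281228493, 9738894594010, 10288430500385, 9827021922463, 9898969894866, 10528392372325, 9658926958054,
9655689629014, 10290421822161, 9726873537201, 10697553443832, 9744639113886, 10008793190896, 9632894464468, 10054298932389, 10293310788698, 9936336254406, 9371394525829, 10880818469529,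
9438926198421, 10784146068231, 9052654888925, 10216751307593, 10933888278223, 8560414686974, 12265308201375, 7215558145159, 11497191180344, 9574218083539, 9454514829017, 11414676146093,
8798198604236, 11344018008345, 9035065952023, 9641375595857, 10798922063995, 8920224329969, 11712367225787, 8696151901898, 10749838989034, 9068796405462, 10420269636152, 9942105987914,
11840634701896, 6603598506029, 13827669726146, 4815860076922, 14903989961747, 7123918631108, 11722815865484, 9627406101233, 9403037943532, 10895387140470, 8596343111620, 10916702245119,
10608347763793, 7938144662708, 13548391217258, 4856596838681, 14479263491228, 8606840550622, 9342441972770, 11660177144413, 6459363124161, 14228696334836, 6213667806952, 13283087296960,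
8734655410955, 8754678611199, 12759983321854, 6975010101167, 12239666022624, 9597852298013, 8987167619302, 12087614094823, 5611251757291, 14964115234476, 6179948433815, 13471445808468,
8117962373925, 9938546763935, 10769570550798, 8996982143753, 10159127306370, 11081360677836, 8882563481148, 11138110641904, 7437192600133, 13454490790540, 6782618910952, 12592590065033,
9078265971748, 9672025146469, 10365819144460, 9154976232860, 10657315271193, 9997712945286, 10048055410710, 10467921483551, 9096603868287, 10860147866187, 8848935969395, 11018087980286,
9564697729418, 9770723835040, 10584717564562, 9308400910901, 10785938357606, 9380328912867, 10459487464873, 10073441508664, 9422676944595, 10555624004927, 9565561933776, 10242407763338,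
9804909508089, 10177904574224, 10118652462360, 9606192345905, 10660787478734, 9330663549728, 10390863025544, 10024888706756, 9519357158430, 10439293169044, 9732444724558, 10227532222220,
9855844578476, 10006984614817, 10149000586795, 9756425970477, 10257322864009, 9766307683904, 10169593728583, 9977399782091, 9870544048163, 10209243008202, 9758969561739, 10301707147402,
9844910814563, 10056948736961, 9955118678113, 9985567632475, 9979608153341, 10052614630562, 9929232225304, 10108040997051, 9928465044857, 10068355002194, 9838410952063, 10150716638429,
9896704879551, 10061154652466, 9937360699374, 10069787936146, 9934563737435, 10049528038601, 9950069152044, 10053510422084, 9950950363439, 10052510645950, 9956742145964, 10025060340748,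
9979760893959, 10039563694151, 9953108383277, 10037345675143, 9982061592672, 10022425011617, 9976482768272, 10012442209687, 9984068145972, 10017284779230, 9979470691950, 10015125054942,
9989273678600, 10014890985003, 9985042986587, 10009973159722, 9990088389018, 10009737011738, 9992094010136, 10005979630418, 9991057814269, 10008228210949, 9994621209356, 10006733705466,
9992866855811, 10006410285252, 9997370919031, 10000570793820, 9997684905922, 10003680122414, 9995971854071, 10004343428926, 9996295556899, 10002290966254, 9998722616669, 10001069314068,
9998962087138, 10000594365027, 9999530780608, 10000345346471, 10000000694547, 9999943005767, 9999985139545, 9999750064174, 9999930713421, 10000216142705, 10000205010170, 9999882479243,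
10000537025658, 9999496517687, 10000242806151, 9999550513856, 10000319570262, 9999521893850, 10000623848863, 9999485603045, 10000458594331, 9999783235018, 10000160265366, 9999822008700,
10000158108336, 9999800933771, 10000227106421, 9999801290298, 10000140263944, 9999887639338, 10000101153700, 9999899771985, 10000069272187, 9999955961549, 10000086900035, 9999935977826,
10000027904936, 9999970886312, 10000027549087, 9999963267317, 10000028175225, 9999987258111, 10000009384603, 9999996895353, 10000004691770, 9999987778259, 10000010656364, 9999995913595,
10000008412621, 9999992686904, 10000003848436, 9999995032223, 10000000288492, 9999996193737, 10000001867931, 9999999676403, 10000003591794, 9999998388849, 9999999712295, 9999997589395,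
10000000917295, 9999999009744, 9999999822296, 10000000577203, 9999999561369, 10000000022201, 9999999989954, 9999999865002, 10000000338653, 10000000364420, 10000000436555, 9999999286532,
10000000292253, 9999999553963, 10000000257677, 9999999848341, 9999999920993, 10000000214999, 10000000046501, 10000000071132, 9999999957348, 10000000090360, 9999999929844, 9999999980137,
9999999982554, 9999999928601, 10000000045625, 10000000018287, 9999999998085, 9999999990877, 9999999995294, 10000000001496, 9999999989024, 10000000011579, 9999999983740, 10000000008875,
10000000003735, 9999999998439, 10000000000417, 9999999999581, 10000000001331, 10000000000508, 10000000005149, 9999999997848, 10000000001178, 10000000002198, 9999999998385, 9999999997651,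
10000000000027, 10000000000023, 10000000000167, 10000000000201, 9999999999765, 10000000000139, 9999999999977, 9999999999844, 10000000000164, 10000000000003, 10000000000024, 10000000000014,
10000000000172, 9999999999848, 10000000000000, 10000000000004, 9999999999998, 10000000000001, 9999999999990, 10000000000000, 9999999999999, 10000000000000, 10000000000001, 9999999999998,
10000000000001, 10000000000001, 9999999999998, 10000000000000, 10000000000000, 10000000000000, 9999999999999, 10000000000001]


/-! ## Part C: the Krylov computation -/

theorem digit_of (B : ℕ) (hB : 0 < B) (l : List ℕ) (h : ∀ x ∈ l, x < B) :
    ∀ t, Nat.ofDigits B l / B ^ t % B = l.getD t 0 := by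
  induction l with
  | nil => intro t; simp [Nat.ofDigits]
  | cons a l ih =>
    have ha : a < B := h a (by simp)
    intro t
    rw [Nat.ofDigits_cons]
    cases t with
    | zero => simp [Nat.add_mul_mod_self_left, Nat.mod_eq_of_lt ha]
    | succ t =>
      rw [pow_succ', ← Nat.div_div_eq_div_mul, Nat.add_mul_div_left _ _ hB, Nat.div_eq_of_lt ha,
        Nat.zero_add, ih (fun x hx => h x (List.mem_cons_of_mem _ hx))]
      simp

@[irreducible] def BC : ℕ := 2 ^ 768
theorem BC_eq : BC = 2 ^ 768 := by unfold BC; rfl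
theorem BC_pos : 0 < BC := by decide +kernel

inductive Row : Type
  | nil : Row
  | one : ℕ → ℕ → Row → Row
  | mul : ℕ → ℕ → ℕ → Row → Row

noncomputable section

def mkRow (f : ℕ) : ℕ → (Row → Bool) → Bool :=
  Nat.rec (motive := fun _ => ℕ → (Row → Bool) → Bool) (fun _ k => k Row.nil)
    (fun _ ih m k => bif Nat.ble 1 m then
      forceN (m % 1000 / 28) (fun j => forceN (768 * (m % 1000 % 28)) (fun s =>
        ih (Nat.div m 1000000) (fun r =>
          bif Nat.beq (m / 1000 % 1000) 1 then k (Row.one j s r)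
          else forceN (m / 1000 % 1000) (fun c => k (Row.mul j s c r)))))
      else k Row.nil) f

def mkBlk (l : List ℕ) : (List Row → Bool) → Bool :=
  List.rec (motive := fun _ => (List Row → Bool) → Bool) (fun k => k [])
    (fun m _ ih k => mkRow 12 (m / 100000000000) (fun r => ih (fun b => k (r :: b)))) l

def mkAll (l : List (List ℕ)) : (List (List Row) → Bool) → Bool :=
  List.rec (motive := fun _ => (List (List Row) → Bool) → Bool) (fun k => k [])
    (fun b _ ih k => mkBlk b (fun r => ih (fun t => k (r :: t)))) l

/-- split a number into base-`BB` digits -/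
def withBl {α : Type} (BB n : ℕ) : ℕ → (List ℕ → α) → α :=
  Nat.rec (motive := fun _ => ℕ → (List ℕ → α) → α) (fun _ k => k [])
    (fun _ ih U k => forceN (Nat.land U (Nat.sub BB 1)) fun b => forceN (Nat.div U BB) fun U' =>
      ih U' fun l => k (b :: l)) n

def rowV (mask : ℕ) (U : List ℕ) (r : Row) : ℕ :=
  Row.rec (motive := fun _ => ℕ) 0
    (fun j s _ ih => Nat.add (Nat.land (Nat.shiftRight (getL 0 U j) s) mask) ih)
    (fun j s m _ ih => Nat.add (Nat.mul m (Nat.land (Nat.shiftRight (getL 0 U j) s) mask)) ih) r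

def blkV (mask B : ℕ) (U : List ℕ) (l : List Row) : ℕ :=
  List.rec (motive := fun _ => ℕ) 0 (fun r _ ih => Nat.add (rowV mask U r) (Nat.mul B ih)) l

def stepB (mask B BB : ℕ) (l : List (List Row)) (U : List ℕ) : ℕ :=
  List.rec (motive := fun _ => ℕ) 0 (fun b _ ih => Nat.add (blkV mask B U b) (Nat.mul BB ih)) l

def stepV (mask B BB : ℕ) (l : List (List Row)) (U : ℕ) : ℕ :=
  withBl BB 36 U (stepB mask B BB l)

def iterV (mask B BB : ℕ) (l : List (List Row)) (n : ℕ) : ℕ → ℕ :=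
  Nat.rec (motive := fun _ => ℕ → ℕ) (fun U => U)
    (fun _ ih U => forceN (stepV mask B BB l U) ih) n

def gblk (B : ℕ) (l : List ℕ) : ℕ :=
  List.rec (motive := fun _ => ℕ) 0 (fun r _ ih => Nat.add (r / 10000000 % 10000) (Nat.mul B ih)) l
def gall (B BB : ℕ) (l : List (List ℕ)) : ℕ :=
  List.rec (motive := fun _ => ℕ) 0 (fun b _ ih => Nat.add (gblk B b) (Nat.mul BB ih)) l

def loopC (st : ℕ → ℕ) (cs : List ℕ) : ℕ → ℕ → ℕ → (ℕ → ℕ → ℕ → Bool) → Bool :=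
  List.rec (motive := fun _ => ℕ → ℕ → ℕ → (ℕ → ℕ → ℕ → Bool) → Bool)
    (fun U P S k => k U P S)
    (fun c _ ih U P S k => forceN (st U) fun U' => forceN (P + c * U) fun P' =>
      forceN (S + U) fun S' => ih U' P' S' k) cs

def offF : ℕ := 10000000000000

def digV (mask : ℕ) (U : List ℕ) (i : ℕ) : ℕ :=
  Nat.land (Nat.shiftRight (getL 0 U (i / 28)) (768 * (i % 28))) mask

def ratC (mask : ℕ) (U V : List ℕ) (i : ℕ) : Bool :=
  forceN (digV mask U i) fun x => forceN (digV mask V i) fun y =>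
    bif Nat.ble (144533001171 * x) (100000000000 * y) then
      Nat.ble (100000000000 * y) (144533001175 * x) else false

def mainC : Bool :=
  forceN (BC - 1) fun mask => forceN BC fun B => forceN (B ^ 28) fun BB =>
  mkAll rowT fun rows =>
  bif forceN (iterV mask B BB rows 21 1) (fun E => withBl BB 36 E fun E =>
    allN (fun i => Nat.ble 1 (digV mask E i)) 786) then
  forceN (gall B BB rowT) fun U0 =>
  forceN (iterV mask B BB rows 23 U0) fun U =>
  loopC (stepV mask B BB rows) fT U 0 0 fun U P S =>
    bif Nat.beq P (offF * S) then
    withBl BB 36 U fun bU =>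
    bif Nat.ble 1 (digV mask bU 0) then
      forceN (stepV mask B BB rows U) fun V => withBl BB 36 V fun bV => allN (ratC mask bU bV) 788
    else false else false
  else false

theorem mainC_true : mainC = true := by decide +kernel

end

def rowP (f : ℕ) : ℕ → Row :=
  Nat.rec (motive := fun _ => ℕ → Row) (fun _ => Row.nil)
    (fun _ ih m => bif Nat.ble 1 m then
      (bif Nat.beq (m / 1000 % 1000) 1 then Row.one (m % 1000 / 28) (768 * (m % 1000 % 28)) (ih (Nat.div m 1000000))
          else Row.mul (m % 1000 / 28) (768 * (m % 1000 % 28)) (m / 1000 % 1000) (ih (Nat.div m 1000000)))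
      else Row.nil) f

theorem mkRow_eq (f : ℕ) : ∀ m k, mkRow f m k = k (rowP f m) := by
  induction f with
  | zero => intro m k; rfl
  | succ f ih =>
    intro m k
    change (bif Nat.ble 1 m then
      forceN (m % 1000 / 28) (fun j => forceN (768 * (m % 1000 % 28)) (fun s =>
        mkRow f (Nat.div m 1000000) (fun r =>
          bif Nat.beq (m / 1000 % 1000) 1 then k (Row.one j s r)
          else forceN (m / 1000 % 1000) (fun c => k (Row.mul j s c r)))))
      else k Row.nil) = k (bif Nat.ble 1 m then
      (bif Nat.beq (m / 1000 % 1000) 1 then Row.one (m % 1000 / 28) (768 * (m % 1000 % 28)) (rowP f (Nat.div m 1000000))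
          else Row.mul (m % 1000 / 28) (768 * (m % 1000 % 28)) (m / 1000 % 1000) (rowP f (Nat.div m 1000000)))
      else Row.nil)
    rw [forceN_eq, forceN_eq, ih, forceN_eq]
    cases Nat.ble 1 m
    · rfl
    · cases Nat.beq (m / 1000 % 1000) 1 <;> rfl

def rowQ (m : ℕ) : Row := rowP 12 (m / 100000000000)

theorem mkBlk_eq (l : List ℕ) : ∀ k, mkBlk l k = k (l.map rowQ) := by
  induction l with
  | nil => intro k; rfl
  | cons a l ih =>
    intro k
    change mkRow 12 (a / 100000000000) (fun r => mkBlk l (fun b => k (r :: b))) = _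
    rw [mkRow_eq, ih]; rfl

theorem mkAll_eq (l : List (List ℕ)) : ∀ k, mkAll l k = k (l.map (List.map rowQ)) := by
  induction l with
  | nil => intro k; rfl
  | cons a l ih =>
    intro k
    change mkBlk a (fun r => mkAll l (fun b => k (r :: b))) = _
    rw [mkBlk_eq, ih]; rfl

def digC (U t : ℕ) : ℕ := U / BC ^ t % BC

def blks (n : ℕ) : ℕ → List ℕ :=
  Nat.rec (motive := fun _ => ℕ → List ℕ) (fun _ => [])
    (fun _ ih U => U % BC ^ 28 :: ih (U / BC ^ 28)) n

theorem withBl_eq {α : Type} (n : ℕ) : ∀ U (k : List ℕ → α),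
    withBl (BC ^ 28) n U k = k (blks n U) := by
  induction n with
  | zero => intro U k; rfl
  | succ n ih =>
    intro U k
    change (forceN (U &&& (BC ^ 28 - 1)) fun b => forceN (U / BC ^ 28) fun U' =>
      withBl (BC ^ 28) n U' fun l => k (b :: l)) = k (U % BC ^ 28 :: blks n (U / BC ^ 28))
    rw [forceN_eq, forceN_eq, ih]
    have e : U &&& (BC ^ 28 - 1) = U % BC ^ 28 := by
      rw [BC_eq, ← pow_mul, Nat.and_two_pow_sub_one_eq_mod]
    rw [e]

theorem getL_blks (n : ℕ) : ∀ U j, j < n → getL 0 (blks n U) j = U / (BC ^ 28) ^ j % BC ^ 28 := by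
  induction n with
  | zero => intro U j h; omega
  | succ n ih =>
    intro U j h
    cases j with
    | zero =>
      rw [pow_zero, Nat.div_one]; rfl
    | succ j =>
      change getL 0 (blks n (U / BC ^ 28)) j = _
      rw [ih _ _ (by omega), Nat.div_div_eq_div_mul, pow_succ' _ j]

theorem digV_eq (U t : ℕ) (ht : t < 1000) :
    Nat.land (Nat.shiftRight (getL 0 (blks 36 U) (t / 28)) (768 * (t % 28))) (BC - 1) =
      digC U t := by
  rw [getL_blks _ _ _ (by omega)]
  have h28 : t % 28 < 28 := Nat.mod_lt _ (by norm_num)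
  have ht2 : 28 * (t / 28) + t % 28 = t := Nat.div_add_mod t 28
  generalize t / 28 = j at *
  generalize t % 28 = s at *
  subst ht2
  have e1 : ∀ x, Nat.land (Nat.shiftRight x (768 * s)) (BC - 1) = x / BC ^ s % BC := by
    intro x
    change (x >>> (768 * s)) &&& (BC - 1) = _
    rw [BC_eq, Nat.and_two_pow_sub_one_eq_mod, Nat.shiftRight_eq_div_pow, pow_mul]
  rw [e1, digC]
  have e2 : BC ^ 28 = BC ^ s * BC ^ (28 - s) := by rw [← pow_add]; congr 1; omega
  have e3 : BC ^ (28 * j + s) = (BC ^ 28) ^ j * BC ^ s := by rw [pow_add, pow_mul]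
  rw [e3, ← Nat.div_div_eq_div_mul]
  generalize U / (BC ^ 28) ^ j = V
  rw [e2, Nat.mod_mul_right_div_self, Nat.mod_mod_of_dvd]
  exact dvd_pow_self _ (by omega)

theorem rowV_eq (U f : ℕ) : ∀ m, rowV (BC - 1) (blks 36 U) (rowP f m) = ((outD f m).map (digC U)).sum := by
  induction f with
  | zero => intro m; rfl
  | succ f ih =>
    intro m
    change rowV (BC - 1) (blks 36 U) (bif Nat.ble 1 m then
      (bif Nat.beq (m / 1000 % 1000) 1 then Row.one (m % 1000 / 28) (768 * (m % 1000 % 28)) (rowP f (Nat.div m 1000000))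
          else Row.mul (m % 1000 / 28) (768 * (m % 1000 % 28)) (m / 1000 % 1000) (rowP f (Nat.div m 1000000)))
      else Row.nil) = ((bif Nat.ble 1 m then
      List.replicate (m / 1000 % 1000) (m % 1000) ++ outD f (Nat.div m 1000000) else []).map (digC U)).sum
    cases Nat.ble 1 m
    · rfl
    · by_cases h : m / 1000 % 1000 = 1
      · rw [h, Nat.beq_refl]
        change Nat.land (Nat.shiftRight (getL 0 (blks 36 U) (m % 1000 / 28)) (768 * (m % 1000 % 28))) (BC - 1) +
          rowV (BC - 1) (blks 36 U) (rowP f (Nat.div m 1000000)) = _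
        rw [digV_eq _ _ (Nat.mod_lt _ (by norm_num)), ih]
        simp
      · rw [beq_ff h]
        change (m / 1000 % 1000) * Nat.land (Nat.shiftRight (getL 0 (blks 36 U) (m % 1000 / 28)) (768 * (m % 1000 % 28))) (BC - 1) +
          rowV (BC - 1) (blks 36 U) (rowP f (Nat.div m 1000000)) = _
        rw [digV_eq _ _ (Nat.mod_lt _ (by norm_num)), ih]
        simp

theorem blkV_eq (mask B : ℕ) (U : List ℕ) (l : List Row) :
    blkV mask B U l = Nat.ofDigits B (l.map (rowV mask U)) := by
  induction l with
  | nil => rfl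
  | cons a l ih =>
    rw [List.map_cons, Nat.ofDigits_cons, ← ih]; rfl

theorem stepB_eq (mask B : ℕ) (U : List ℕ) (l : List (List Row)) (h : ∀ b ∈ l, b.length = 28) :
    stepB mask B (B ^ 28) l U = Nat.ofDigits B (l.flatten.map (rowV mask U)) := by
  induction l with
  | nil => rfl
  | cons a l ih =>
    rw [List.flatten_cons, List.map_append, Nat.ofDigits_append, List.length_map, h a (by simp),
      ← ih (fun b hb => h b (List.mem_cons_of_mem _ hb)), ← blkV_eq]; rfl

theorem gblk_eq (B : ℕ) (l : List ℕ) :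
    gblk B l = Nat.ofDigits B (l.map (fun r => r / 10000000 % 10000)) := by
  induction l with
  | nil => rfl
  | cons a l ih =>
    rw [List.map_cons, Nat.ofDigits_cons, ← ih]; rfl

theorem gall_eq (B : ℕ) (l : List (List ℕ)) (h : ∀ b ∈ l, b.length = 28) :
    gall B (B ^ 28) l = Nat.ofDigits B (l.flatten.map (fun r => r / 10000000 % 10000)) := by
  induction l with
  | nil => rfl
  | cons a l ih =>
    rw [List.flatten_cons, List.map_append, Nat.ofDigits_append, List.length_map, h a (by simp),
      ← ih (fun b hb => h b (List.mem_cons_of_mem _ hb)), ← gblk_eq]; rfl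

def allL {α : Type} (p : α → Bool) (l : List α) : Bool :=
  List.rec (motive := fun _ => Bool) true (fun a _ b => bif p a then b else false) l

theorem allL_spec {α : Type} (p : α → Bool) (l : List α) (h : allL p l = true) :
    ∀ a ∈ l, p a = true := by
  induction l with
  | nil => simp
  | cons x l ih =>
    change (bif p x then allL p l else false) = true at h
    obtain ⟨h1, h2⟩ := cond_and h
    intro a ha
    rcases List.mem_cons.1 ha with e | e
    · rw [e]; exact h1
    · exact ih h2 a e

@[irreducible] def rg : List ℕ := List.range 812
theorem rg_eq : rg = List.range 812 := by unfold rg; rfl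
theorem mem_rg {x : ℕ} : x ∈ rg ↔ x < 812 := by rw [rg_eq]; exact List.mem_range
theorem getD_range (n : ℕ) (f : ℕ → ℕ) (t : ℕ) (ht : t < n) :
    ((List.range n).map f).getD t 0 = f t := by
  rw [List.getD_eq_getElem _ _ (by simpa using ht)]; simp
theorem getD_rg (f : ℕ → ℕ) (t : ℕ) (ht : t < 812) : (rg.map f).getD t 0 = f t := by
  rw [rg_eq]; exact getD_range _ f t ht

theorem chkC1 : allL (fun b => Nat.beq (lenL b 0) 28) rowT = true := by decide +kernel
theorem chkC2 : beqL rowT.flatten (rg.map rowN) = true := by decide +kernel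
theorem chkC3 : allN (fun i => Nat.ble (lenL (outN i) 0) 1000) 812 = true := by decide +kernel
theorem chkC4 : allN (fun i => beqL (outN (788 + i)) []) 24 = true := by decide +kernel

theorem rowT_len : ∀ b ∈ rowT, b.length = 28 := by
  intro b hb
  have := allL_spec _ _ chkC1 b hb
  rw [Nat.beq_eq, lenL_eq] at this
  exact this

theorem rowT_flat : rowT.flatten = rg.map rowN := beqL_eq _ _ chkC2

theorem outN_len (i : ℕ) (hi : i < 812) : (outN i).length ≤ 1000 := by
  have := allN_spec _ _ chkC3 i hi
  rw [Nat.ble_eq, lenL_eq] at this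
  exact this

theorem outN_nil (i : ℕ) (h : 788 ≤ i) (hi : i < 812) : outN i = [] := by
  obtain ⟨j, rfl⟩ := Nat.exists_eq_add_of_le h
  have hj : j < 24 := by omega
  have := allN_spec (fun i => beqL (outN (788 + i)) []) 24 chkC4 j hj
  exact beqL_eq _ _ this

theorem outN_lt' (s : ℕ) (hs : s < 812) : ∀ t ∈ outN s, t < 812 := by
  intro t ht
  by_cases h : s < 788
  · have := outN_lt s h t ht; omega
  · rw [outN_nil s (by omega) hs] at ht; simp at ht

/-- packing of a vector -/
def pk (f : ℕ → ℕ) : ℕ := Nat.ofDigits BC (rg.map f)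

def TN (f : ℕ → ℕ) (s : ℕ) : ℕ := ((outN s).map f).sum

theorem dig_pk (f : ℕ → ℕ) (hf : ∀ i < 812, f i < BC) (t : ℕ) (ht : t < 812) :
    digC (pk f) t = f t := by
  rw [digC, pk, digit_of _ BC_pos]
  · exact getD_rg f t ht
  · intro x hx
    obtain ⟨i, hi, rfl⟩ := List.mem_map.1 hx
    exact hf i (mem_rg.1 hi)

def rowsA : List (List Row) := rowT.map (List.map rowQ)
noncomputable def stepA (U : ℕ) : ℕ := stepV (BC - 1) BC (BC ^ 28) rowsA U

theorem stepA_pk (f : ℕ → ℕ) (hf : ∀ i < 812, f i < BC) : stepA (pk f) = pk (TN f) := by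
  rw [stepA, stepV, withBl_eq, stepB_eq, rowsA, ← List.map_flatten, rowT_flat, pk, List.map_map, List.map_map]
  · congr 1
    apply List.map_congr_left
    intro i hi
    have hi' := mem_rg.1 hi
    simp only [Function.comp]
    rw [rowQ, rowV_eq]
    change ((outN i).map _).sum = ((outN i).map f).sum
    congr 1
    apply List.map_congr_left
    intro t ht
    exact dig_pk f hf t (outN_lt' i hi' t ht)
  · intro b hb
    obtain ⟨c, hc, rfl⟩ := List.mem_map.1 hb
    rw [List.length_map]; exact rowT_len c hc

theorem g_pk : gall BC (BC ^ 28) rowT = pk (uN 0) := by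
  rw [gall_eq _ _ rowT_len, rowT_flat, List.map_map]; rfl

theorem iterV_gen (mask B BB : ℕ) (l : List (List Row)) (n : ℕ) : ∀ U,
    iterV mask B BB l n U = (stepV mask B BB l)^[n] U := by
  induction n with
  | zero => intro U; rfl
  | succ n ih =>
    intro U
    change forceN (stepV mask B BB l U) (iterV mask B BB l n) = _
    rw [forceN_eq, ih]; rfl

theorem stepA_eq : stepV (BC - 1) BC (BC ^ 28) rowsA = stepA := by
  funext U; rw [stepA]

theorem iterV_eq (n U : ℕ) :
    iterV (BC - 1) BC (BC ^ 28) rowsA n U = stepA^[n] U := by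
  rw [iterV_gen, stepA_eq]

theorem uN_bound (n i : ℕ) (hi : i < 812) : uN n i ≤ 3 ^ n * 10000 := by
  by_cases h : i < 788
  · have h1 : uN n i ≤ 3 ^ n * uN 0 i := by
      induction n with
      | zero => simp
      | succ n ih =>
        have := (PW3 n i h).2
        simp only [uR] at this
        have : uN (n + 1) i ≤ 3 * uN n i := by exact_mod_cast this
        rw [pow_succ]; linarith
    have h2 : uN 0 i < 10000 := Nat.mod_lt _ (by norm_num)
    calc _ ≤ _ := h1
      _ ≤ _ := by gcongr
  · cases n with
    | zero =>
      have h2 : uN 0 i < 10000 := Nat.mod_lt _ (by norm_num)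
      simp; omega
    | succ n => rw [uN_succ, outN_nil i (by omega) hi]; simp

@[irreducible] def UB : ℕ := 3 ^ 440 * 10000
theorem UB_eq : UB = 3 ^ 440 * 10000 := by unfold UB; rfl
theorem big2 : 1000 ^ 21 < BC := by decide +kernel
theorem big1 : UB * (416 * 20000000000000) < BC := by decide +kernel

theorem uN_bound' (n i : ℕ) (hn : n ≤ 440) (hi : i < 812) : uN n i ≤ UB := by
  rw [UB_eq]
  refine (uN_bound n i hi).trans ?_
  exact Nat.mul_le_mul_right _ (Nat.pow_le_pow_right (by norm_num) hn)

theorem uN_lt (n i : ℕ) (hn : n ≤ 440) (hi : i < 812) : uN n i < BC := by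
  have h1 := uN_bound' n i hn hi
  have h2 := big1
  omega

theorem stepA_u (n : ℕ) (hn : n ≤ 440) : stepA (pk (uN n)) = pk (uN (n + 1)) :=
  stepA_pk _ fun i hi => uN_lt n i hn hi

theorem iterA_u (n : ℕ) (hn : n ≤ 440) : stepA^[n] (pk (uN 0)) = pk (uN n) := by
  induction n with
  | zero => rw [Function.iterate_zero_apply]
  | succ n ih => rw [Function.iterate_succ_apply', ih (by omega), stepA_u n (by omega)]

def combP (cs : List ℕ) : ℕ → ℕ → ℕ :=
  List.rec (motive := fun _ => ℕ → ℕ → ℕ) (fun _ _ => 0)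
    (fun c _ ih n i => c * uN n i + ih (n + 1) i) cs

theorem combP_cons (c : ℕ) (cs : List ℕ) (n i : ℕ) :
    combP (c :: cs) n i = c * uN n i + combP cs (n + 1) i := rfl

theorem pk_lin (c : ℕ) (f g : ℕ → ℕ) : pk (fun i => c * f i + g i) = c * pk f + pk g := by
  unfold pk
  induction rg with
  | nil => rfl
  | cons a l ih => simp only [List.map_cons, Nat.ofDigits_cons, ih]; ring

theorem pk_zero : pk (fun _ => 0) = 0 := by
  have := pk_lin 1 (fun _ => 0) (fun _ => 0)
  simp only [Nat.mul_zero, Nat.add_zero, Nat.one_mul] at this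
  omega

def ones (cs : List ℕ) : List ℕ := cs.map fun _ => 1

theorem loopC_eq (cs : List ℕ) : ∀ n P S k, n + cs.length ≤ 440 →
    loopC stepA cs (pk (uN n)) P S k =
      k (pk (uN (n + cs.length))) (P + pk (combP cs n)) (S + pk (combP (ones cs) n)) := by
  induction cs with
  | nil =>
    intro n P S k _
    have h0 : pk (combP [] n) = 0 := pk_zero
    change k (pk (uN n)) P S = _
    rw [show ones [] = [] from rfl, h0]; rfl
  | cons c cs ih =>
    intro n P S k hn
    rw [List.length_cons] at hn
    change (forceN (stepA (pk (uN n))) fun U' => forceN (P + c * pk (uN n)) fun P' =>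
      forceN (S + pk (uN n)) fun S' => loopC stepA cs U' P' S' k) = _
    rw [forceN_eq, forceN_eq, forceN_eq, stepA_u n (by omega), ih _ _ _ _ (by omega)]
    have e1 : pk (combP (c :: cs) n) = c * pk (uN n) + pk (combP cs (n + 1)) := pk_lin _ _ _
    have e2 : pk (combP (ones (c :: cs)) n) = 1 * pk (uN n) + pk (combP (ones cs) (n + 1)) :=
      pk_lin _ _ _
    rw [e1, e2, List.length_cons, one_mul, add_assoc P, add_assoc S, Nat.add_assoc n 1,
      Nat.add_comm 1]

theorem combP_le (M : ℕ) (cs : List ℕ) : ∀ n i, i < 812 → n + cs.length ≤ 440 →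
    (∀ c ∈ cs, c ≤ M) → combP cs n i ≤ UB * (cs.length * M) := by
  induction cs with
  | nil => intro n i _ _ _; simp [combP]
  | cons c cs ih =>
    intro n i hi hn hc
    rw [List.length_cons] at hn ⊢
    rw [combP_cons]
    have h1 := ih (n + 1) i hi (by omega) (fun c h => hc c (List.mem_cons_of_mem _ h))
    have h2 := uN_bound' n i (by omega) hi
    have h3 := hc c (by simp)
    have h4 := Nat.mul_le_mul h3 h2
    calc _ ≤ M * UB + UB * (cs.length * M) := Nat.add_le_add h4 h1
      _ = _ := by ring

def e0N (t : ℕ) : ℕ := if t = 0 then 1 else 0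

theorem TNi_le (n : ℕ) : ∀ i < 812, TN^[n] e0N i ≤ 1000 ^ n := by
  induction n with
  | zero => intro i _; simp [e0N]; split_ifs <;> simp
  | succ n ih =>
    intro i hi
    rw [Function.iterate_succ_apply', TN]
    have h1 : ((outN i).map (TN^[n] e0N)).sum ≤ ((outN i).map (TN^[n] e0N)).length • 1000 ^ n := by
      apply List.sum_le_card_nsmul
      intro x hx
      obtain ⟨t, ht, rfl⟩ := List.mem_map.1 hx
      exact ih t (outN_lt' i hi t ht)
    refine h1.trans ?_
    rw [List.length_map, smul_eq_mul, pow_succ']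
    exact Nat.mul_le_mul_right _ (outN_len i hi)

theorem e0_pk : pk e0N = 1 := by
  have h : ∀ l : List ℕ, (∀ x ∈ l, x ≠ 0) → Nat.ofDigits BC (l.map e0N) = 0 := by
    intro l hl
    induction l with
    | nil => rfl
    | cons a l ih =>
      rw [List.map_cons, Nat.ofDigits_cons, ih (fun x hx => hl x (List.mem_cons_of_mem _ hx))]
      simp [e0N, hl a (by simp)]
  rw [pk, rg_eq, List.range_succ_eq_map, List.map_cons, Nat.ofDigits_cons, h]
  · simp [e0N]
  · intro x hx
    obtain ⟨y, _, rfl⟩ := List.mem_map.1 hx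
    simp

theorem iterA_e (n : ℕ) (hn : n ≤ 21) : stepA^[n] 1 = pk (TN^[n] e0N) := by
  induction n with
  | zero => exact e0_pk.symm
  | succ n ih =>
    rw [Function.iterate_succ_apply', ih (by omega), stepA_pk, Function.iterate_succ_apply']
    intro i hi
    refine lt_of_le_of_lt (TNi_le n i hi) ?_
    refine lt_of_le_of_lt (Nat.pow_le_pow_right (by norm_num) (show n ≤ 21 by omega)) big2

theorem fT_facts : lenL fT 0 = 416 ∧ allL (fun c => Nat.ble c 20000000000000) fT = true := by
  decide +kernel

theorem fT_len : fT.length = 416 := by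
  have := fT_facts.1
  rwa [lenL_eq] at this

theorem mainC_pre : 
    allN (fun i => Nat.ble 1 (digV (BC - 1) (blks 36 (pk (TN^[21] e0N))) i)) 786 = true ∧
    (Nat.beq (0 + pk (combP fT 23)) (offF * (0 + pk (combP (ones fT) 23))) = true) ∧
    Nat.ble 1 (digV (BC - 1) (blks 36 (pk (uN 439))) 0) = true ∧
    allN (ratC (BC - 1) (blks 36 (pk (uN 439))) (blks 36 (pk (uN 440)))) 788 = true := by
  have h := mainC_true
  unfold mainC at h
  rw [forceN_eq, forceN_eq, forceN_eq, mkAll_eq] at h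
  obtain ⟨h1, h⟩ := cond_and h
  rw [forceN_eq] at h1
  rw [forceN_eq, forceN_eq] at h
  rw [← rowsA] at h1 h
  simp only [stepA_eq] at h
  rw [withBl_eq, iterV_eq, iterA_e 21 le_rfl] at h1
  refine ⟨h1, ?_⟩
  have e1 : 23 ≤ 440 := by norm_num
  have e3 : 439 ≤ 440 := by norm_num
  have e2 : 23 + fT.length ≤ 440 := by rw [fT_len]; norm_num
  have e4 : 23 + fT.length = 439 := by rw [fT_len]
  rw [iterV_eq, g_pk, iterA_u 23 e1, loopC_eq fT 23 0 0 _ e2, e4] at h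
  obtain ⟨h2, h⟩ := cond_and h
  rw [withBl_eq] at h
  obtain ⟨h3, h⟩ := cond_and h
  rw [forceN_eq, stepA_u 439 e3, withBl_eq] at h
  exact ⟨h2, h3, h⟩

theorem mainC_s1 : ∀ i < 786, 1 ≤ TN^[21] e0N i := by
  intro i hi
  have := allN_spec _ _ mainC_pre.1 i hi
  rw [digV, digV_eq _ _ (by omega), dig_pk _ (fun i hi => lt_of_le_of_lt (TNi_le 21 i hi) big2) _ (by omega),
    Nat.ble_eq] at this
  exact this

theorem h5 (i : ℕ) (hi : i < 812) : combP fT 23 i < BC := by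
  refine lt_of_le_of_lt (combP_le 20000000000000 fT 23 i hi (by rw [fT_len]; norm_num) ?_) ?_
  · intro c hc
    have := allL_spec _ _ fT_facts.2 c hc
    rwa [Nat.ble_eq] at this
  · rw [fT_len]; exact big1

theorem h6 (i : ℕ) (hi : i < 812) : offF * combP (ones fT) 23 i + 0 < BC := by
  have hl : (ones fT).length = 416 := by rw [ones, List.length_map, fT_len]
  have h7 := combP_le 1 (ones fT) 23 i hi (by rw [hl]; norm_num) (by
    intro c hc
    obtain ⟨y, _, rfl⟩ := List.mem_map.1 hc
    exact le_rfl)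
  rw [hl] at h7
  have h8 := big1
  unfold offF
  generalize combP (ones fT) 23 i = x at *
  generalize UB = y at *
  generalize BC = z at *
  omega

theorem mainC_s2 (i : ℕ) (hi : i < 788) : combP fT 23 i = offF * combP (ones fT) 23 i := by
  have h2 := mainC_pre.2.1
  rw [Nat.beq_eq, Nat.zero_add, Nat.zero_add] at h2
  have h7 : pk (combP fT 23) = pk (fun i => offF * combP (ones fT) 23 i + 0) := by
    rw [h2, pk_lin offF _ (fun _ => 0), pk_zero, Nat.add_zero]
  have h8 := dig_pk _ h5 i (by omega)
  rw [h7, dig_pk _ h6 i (by omega)] at h8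
  exact h8.symm

theorem mainC_s3 : 1 ≤ uN 439 0 := by
  have h3 := mainC_pre.2.2.1
  rw [digV, digV_eq _ _ (by omega), dig_pk _ (fun i hi => uN_lt 439 i (by norm_num) hi) _ (by norm_num),
      Nat.ble_eq] at h3
  exact h3

theorem mainC_s4 (i : ℕ) (hi : i < 788) : 144533001171 * uN 439 i ≤ 100000000000 * uN 440 i ∧
      100000000000 * uN 440 i ≤ 144533001175 * uN 439 i := by
  have h3 := mainC_pre.2.2.2
  have := allN_spec _ _ h3 i hi
  unfold ratC at this
  rw [forceN_eq, forceN_eq, digV, digV_eq _ _ (by omega), digV, digV_eq _ _ (by omega),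
    dig_pk _ (fun i hi => uN_lt 439 i (by norm_num) hi) _ (by omega),
    dig_pk _ (fun i hi => uN_lt 440 i (by norm_num) hi) _ (by omega)] at this
  obtain ⟨t1, t2⟩ := cond_and this
  rw [Nat.ble_eq] at t1 t2
  exact ⟨t1, t2⟩


theorem TN_cast (f : ℕ → ℕ) : TR (fun t => (f t : ℝ)) = fun s => ((TN f s : ℕ) : ℝ) := by
  funext s
  rw [TN, TR]
  induction outN s with
  | nil => simp
  | cons a l ih => simp only [List.map_cons, List.sum_cons, ih]; push_cast; rfl

theorem TNi_cast (n : ℕ) : TR^[n] e0 = fun s => ((TN^[n] e0N s : ℕ) : ℝ) := by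
  induction n with
  | zero => funext s; rw [Function.iterate_zero_apply, Function.iterate_zero_apply, e0, e0N]; split_ifs <;> simp
  | succ n ih => rw [Function.iterate_succ_apply', ih, TN_cast, Function.iterate_succ_apply']

theorem lam_ex : ∃ lam : ℝ, 1.44533001171 ≤ lam ∧ lam ≤ 1.44533001175 ∧ (∀ n, 0 < uR (439 + n) 0) ∧
      Filter.Tendsto (fun n => uR (n + 1) 0 / uR n 0) Filter.atTop (nhds lam) := by
  refine conv 21 439 ?_ _ _ (by norm_num) ?_ ?_
  · intro i hi
    rw [TNi_cast]
    change (1 : ℝ) ≤ ((TN^[21] e0N i : ℕ) : ℝ)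
    exact_mod_cast mainC_s1 i hi
  · intro i hi
    obtain ⟨h1, h2⟩ := mainC_s4 i hi
    have h1' : (144533001171 : ℝ) * uR 439 i ≤ 100000000000 * uR (439 + 1) i := by
      rw [uR, uR]; exact_mod_cast h1
    have h2' : 100000000000 * uR (439 + 1) i ≤ (144533001175 : ℝ) * uR 439 i := by
      rw [uR, uR]; exact_mod_cast h2
    constructor <;> linarith
  · have := mainC_s3
    rw [uR]; exact_mod_cast this

noncomputable def combR (cs : List ℤ) (n i : ℕ) : ℝ :=
  match cs with
  | [] => 0
  | c :: cs => (c : ℝ) * uR n i + combR cs (n + 1) i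

theorem combR_succ (cs : List ℤ) : ∀ n, combR cs (n + 1) = TR (combR cs n) := by
  induction cs with
  | nil =>
    intro n; funext s
    rw [TR]
    induction outN s with
    | nil => simp [combR]
    | cons a l ih => simp only [List.map_cons, List.sum_cons, ← ih]; simp [combR]
  | cons c cs ih =>
    intro n
    have h := TR_lin c 1 (uR n) (combR cs (n + 1))
    have e : combR (c :: cs) n = fun t => (c : ℝ) * uR n t + 1 * combR cs (n + 1) t := by
      funext t; rw [one_mul]; rfl
    rw [e, h]
    funext s
    rw [one_mul, ← uR_succ, ← ih]; rfl

theorem combR_zero (cs : List ℤ) (N : ℕ) (h : ∀ i < 788, combR cs N i = 0) (m : ℕ) :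
    ∀ i < 788, combR cs (N + m) i = 0 := by
  induction m with
  | zero => exact h
  | succ m ih =>
    intro i hi
    rw [← Nat.add_assoc, combR_succ]
    apply List.sum_eq_zero
    intro x hx
    obtain ⟨t, ht, rfl⟩ := List.mem_map.1 hx
    exact ih t (outN_lt i hi t ht)

def evL {R : Type} [CommRing R] (cs : List ℤ) (x : R) : R :=
  match cs with
  | [] => 0
  | c :: cs => (c : R) + x * evL cs x

theorem combR_tendsto (lam : ℝ) (N : ℕ) (hp : ∀ n, 0 < uR (N + n) 0)
    (h : Filter.Tendsto (fun n => uR (n + 1) 0 / uR n 0) Filter.atTop (nhds lam)) (cs : List ℤ) :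
    Filter.Tendsto (fun n => combR cs n 0 / uR n 0) Filter.atTop (nhds (evL cs lam)) := by
  induction cs with
  | nil => simp only [combR, evL, zero_div]; exact tendsto_const_nhds
  | cons c cs ih =>
    have h1 := (Filter.tendsto_add_atTop_iff_nat (f := fun n => combR cs n 0 / uR n 0) 1).2 ih
    have h2 := (h.mul h1).const_add (c : ℝ)
    refine h2.congr' ?_
    filter_upwards [Filter.eventually_ge_atTop N] with n hn
    obtain ⟨m, rfl⟩ := Nat.exists_eq_add_of_le hn
    have p1 := hp m
    have p2 := hp (m + 1)
    rw [← Nat.add_assoc] at p2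
    rw [combR]
    field_simp

def fZ : List ℤ := fT.map fun c : ℕ => (c : ℤ) - (offF : ℤ)

theorem combR_fZ (i : ℕ) (cs : List ℕ) : ∀ n,
    combR (cs.map fun c : ℕ => (c : ℤ) - (offF : ℤ)) n i
      = (combP cs n i : ℝ) - offF * (combP (ones cs) n i : ℝ) := by
  induction cs with
  | nil => intro n; simp [combR, combP, ones]
  | cons c cs ih =>
    intro n
    have e : combP (ones (c :: cs)) n i = uN n i + combP (ones cs) (n + 1) i := by
      rw [ones, List.map_cons, combP_cons, one_mul]; rfl
    rw [e, combP_cons, List.map_cons, combR, ih, uR]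
    push_cast
    ring

theorem lam_root (lam : ℝ) (hp : ∀ n, 0 < uR (439 + n) 0)
    (h : Filter.Tendsto (fun n => uR (n + 1) 0 / uR n 0) Filter.atTop (nhds lam)) :
    evL fZ lam = 0 := by
  have h0 : ∀ i < 788, combR fZ 23 i = 0 := by
    intro i hi
    rw [fZ, combR_fZ, mainC_s2 i hi]
    push_cast
    ring
  have h1 := combR_tendsto lam 439 hp h fZ
  refine tendsto_nhds_unique h1 (tendsto_const_nhds.congr' ?_)
  filter_upwards [Filter.eventually_ge_atTop 23] with n hn
  obtain ⟨m, rfl⟩ := Nat.exists_eq_add_of_le hn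
  rw [combR_zero fZ 23 h0 m 0 (by norm_num), zero_div]

@[irreducible] def muT : List ℕ := [88, 29, 30, 80, 279, 128, 386, 478, 123, 448, 441, 151, 171, 56, 136, 467, 222, 291, 49, 250, 244, 279, 280, 203, 347, 162, 214, 377, 268, 136,
40, 363, 487, 191, 413, 126, 132, 147, 192, 2, 87, 213, 551, 597, 410, 229, 372, 282, 95, 549, 482, 199, 112, 155, 392, 265, 420, 132, 440, 382, 506, 493, 582, 147, 84, 16, 40,
192, 300, 127, 206, 360, 540, 29, 259, 192, 551, 402, 1, 584, 184, 362, 176, 508, 362, 137, 444, 259, 581, 94, 552, 162, 155, 372, 266, 391, 452, 431, 447, 434, 415, 15, 286, 394,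
220, 437, 187, 158, 585, 531, 585, 294, 8, 144, 290, 29, 223, 256, 371, 283, 54, 60, 368, 86, 520, 72, 49, 99, 382, 577, 174, 440, 528, 373, 30, 351, 5, 210, 143, 390, 286, 478,
94, 111, 29, 341, 244, 565, 136, 469, 289, 338, 323, 184, 445, 364, 93, 37, 352, 276, 165, 245, 258, 115, 435, 11, 294, 215, 555, 469, 439, 549, 539, 236, 182, 520, 514, 220, 430,
567, 577, 565, 148, 167, 214, 365, 323, 252, 356, 61, 177, 382, 444, 5, 11, 369, 589, 570, 122, 121, 32, 251, 70, 254, 464, 408, 440, 450, 578, 501, 445, 377, 131, 476, 11, 320,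
590, 398, 539, 572, 450, 462, 422, 355, 384, 202, 57, 178, 278, 193, 572, 23, 431, 186, 181, 366, 200, 176, 180, 199, 571, 61, 347, 214, 437, 54, 386, 357, 156, 103, 210, 151,
294, 409, 260, 24, 550, 324, 152, 584, 81, 326, 413, 550, 197, 370, 520, 243, 416, 103, 572, 100, 567, 39, 480, 307, 88, 462, 198, 413, 111, 92, 164, 513, 199, 517, 48, 250, 551,
568, 105, 157, 533, 349, 567, 312, 522, 214, 381, 475, 272, 401, 508, 23, 212, 142, 416, 68, 471, 542, 404, 131, 68, 251, 205, 434, 292, 275, 195, 376, 38, 333, 599, 425, 182,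
270, 371, 380, 6, 531, 521, 403, 12, 179, 41, 88, 93, 595, 46, 592, 528, 576, 533, 94, 481, 102, 100, 341, 117, 93, 397, 246, 477, 593, 64, 241, 37, 410, 206, 323, 3, 106, 316,
217, 416, 256, 535, 355, 149, 462, 39, 498, 558, 432, 284, 111, 175, 90, 348, 577, 170, 301, 299, 120, 366, 17, 489, 540, 566, 260, 244, 598, 359, 170, 6, 499, 396, 153, 122, 87,
60, 41, 21, 18, 12, 7, 6, 4, 4, 3, 1, 1, 1, 1, 1]

@[irreducible] def vT : List ℕ := [293, 561, 494, 462, 554, 507, 84, 29, 15, 0, 570, 442, 178, 41, 386, 541, 492, 489, 26, 512, 481, 247, 250, 434, 469, 277, 345, 90, 216, 478,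
151, 74, 110, 64, 242, 117, 139, 81, 503, 304, 83, 74, 258, 184, 267, 537, 514, 361, 172, 135, 102, 503, 302, 409, 56, 74, 327, 340, 325, 447, 547, 373, 65, 290, 192, 274, 347,
280, 277, 457, 53, 169, 507, 346, 376, 111, 514, 210, 19, 516, 46, 118, 370, 293, 61, 155, 8, 261, 59, 441, 55, 543, 69, 399, 491, 201, 548, 98, 480, 542, 250, 289, 492, 462, 339,
21, 210, 99, 243, 210, 358, 434, 542, 504, 512, 241, 81, 225, 46, 273, 592, 329, 102, 270, 537, 136, 541, 213, 404, 425, 586, 433, 596, 388, 139, 250, 286, 565, 572, 402, 227,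
331, 275, 463, 241, 499, 477, 186, 181, 367, 493, 397, 142, 493, 194, 247, 129, 476, 507, 304, 116, 27, 481, 341, 275, 590, 598, 386, 526, 32, 573, 521, 494, 465, 99, 217, 465,
248, 92, 19, 363, 25, 264, 500, 398, 599, 525, 132, 286, 459, 359, 570, 218, 297, 27, 461, 333, 494, 355, 509, 342, 170, 346, 304, 402, 573, 272, 529, 456, 429, 339, 384, 340,
450, 600, 505, 333, 113, 409, 58, 564, 221, 89, 571, 228, 391, 228, 214, 380, 229, 547, 348, 317, 325, 216, 253, 325, 206, 167, 142, 498, 55, 303, 51, 230, 474, 477, 597, 340,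
235, 318, 135, 416, 258, 394, 21, 444, 70, 144, 556, 520, 265, 470, 451, 553, 415, 59, 547, 364, 170, 93, 248, 130, 432, 35, 146, 229, 173, 34, 402, 588, 512, 117, 17, 150, 309,
227, 228, 166, 457, 597, 341, 60, 248, 25, 517, 581, 287, 351, 580, 599, 539, 175, 262, 177, 194, 212, 568, 91, 226, 358, 96, 395, 475, 405, 241, 388, 219, 342, 17, 537, 19, 509,
150, 217, 582, 471, 200, 133, 322, 9, 380, 283, 176, 236, 494, 522, 1, 252, 480, 129, 579, 76, 300, 585, 374, 581, 92, 330, 449, 409, 507, 591, 376, 567, 137, 338, 372, 27, 433,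
346, 483, 513, 75, 64, 512, 577, 577, 426, 121, 43, 407, 137, 386, 206, 466, 190, 562, 18, 435, 497, 77, 382, 314, 153, 439, 30, 39, 516, 216, 130, 370, 62, 365, 243, 198, 178,
183, 326, 337, 60, 324, 132, 51, 303, 576, 0, 67, 184, 291, 7, 578, 557, 21, 253]

@[irreducible] def wT : List ℕ := [230, 285, 262, 207, 425, 483, 448, 573, 555, 403, 1, 435, 393, 379, 223, 189, 206, 198, 205, 169, 563, 32, 411, 186, 312, 497, 484, 188, 1, 92,
485, 306, 55, 426, 300, 534, 38, 60, 458, 204, 228, 440, 340, 122, 388, 570, 163, 58, 370, 168, 280, 162, 327, 254, 594, 413, 197, 201, 534, 595, 57, 471, 403, 578, 542, 213, 184,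
17, 355, 83, 24, 454, 325, 455, 496, 194, 233, 442, 464, 483, 452, 321, 544, 362, 32, 287, 423, 192, 485, 356, 391, 120, 172, 394, 253, 599, 440, 264, 253, 334, 108, 222, 269,
391, 425, 525, 319, 506, 350, 301, 571, 397, 458, 335, 399, 514, 404, 330, 521, 505, 274, 316, 467, 400, 138, 80, 34, 522, 304, 555, 434, 342, 276, 99, 120, 447, 469, 343, 529,
371, 354, 520, 286, 26, 224, 6, 117, 580, 239, 303, 501, 149, 170, 599, 34, 22, 494, 545, 77, 343, 575, 579, 421, 6, 230, 337, 21, 216, 129, 45, 563, 295, 506, 395, 321, 585, 345,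
273, 188, 470, 322, 311, 3, 86, 578, 203, 477, 159, 73, 582, 206, 410, 351, 376, 377, 350, 262, 415, 356, 107, 405, 516, 107, 64, 56, 533, 435, 481, 30, 222, 296, 253, 102, 276,
345, 364, 192, 526, 501, 530, 439, 124, 330, 23, 211, 221, 49, 114, 143, 208, 80, 141, 236, 259, 64, 100, 177, 285, 461, 392, 73, 156, 228, 386, 423, 126, 368, 39, 229, 68, 540,
598, 26, 55, 439, 40, 366, 136, 376, 267, 415, 69, 138, 512, 336, 507, 142, 553, 514, 19, 532, 108, 316, 190, 395, 466, 110, 169, 174, 220, 170, 348, 426, 232, 179, 190, 405, 143,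
561, 555, 551, 203, 181, 223, 40, 562, 366, 83, 47, 206, 496, 467, 354, 352, 395, 384, 535, 430, 315, 302, 48, 490, 13, 177, 452, 185, 227, 133, 13, 68, 479, 166, 83, 14, 39, 495,
589, 34, 1, 444, 364, 547, 462, 94, 16, 295, 561, 553, 166, 276, 214, 598, 31, 149, 136, 298, 577, 464, 240, 487, 488, 431, 397, 83, 354, 120, 79, 263, 166, 242, 22, 443, 63, 402,
251, 451, 8, 230, 254, 564, 561, 82, 131, 303, 303, 158, 63, 212, 72, 177, 145, 585, 205, 33, 215, 310, 203, 363, 542, 45, 329, 133, 465, 525, 378, 284, 257, 215, 468, 429, 88,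
432, 305, 470, 56, 185, 9, 559, 128, 305, 596, 68, 362, 47, 211]


/-! ## Part D: irreducibility modulo 601 -/

noncomputable section

def lowN (B c n : ℕ) : ℕ := Nat.rec (motive := fun _ => ℕ) 0 (fun _ ih => Nat.add c (Nat.mul B ih)) n
def pkL (B : ℕ) (g : ℕ → ℕ) (l : List ℕ) : ℕ :=
  List.rec (motive := fun _ => ℕ) 0 (fun a _ ih => Nat.add (g a) (Nat.mul B ih)) l

def gF (c : ℕ) : ℕ := (22020000000000 - c) % 601

def slotQ (LL w : ℕ) : ℕ := Nat.land (Nat.shiftRight (Nat.mul w 1829470263) 40) LL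

def mmT (F L LL ab X : ℕ) (k : ℕ → Bool) : Bool :=
  forceN (Nat.land X L) fun q =>
  forceN (Nat.add ab (Nat.mul q F)) fun T =>
  forceN (Nat.shiftRight (Nat.mul T 1829470263) 40) fun Y =>
  forceN (Nat.land Y LL) fun Q =>
  forceN (Nat.land (Nat.sub T (Nat.mul 601 Q)) L) fun D =>
    bif Nat.beq (Nat.add D (Nat.mul 601 Q)) T then k D else false

def mmN (F M L LL a b : ℕ) (k : ℕ → Bool) : Bool :=
  forceN (Nat.mul a b) fun ab =>
  forceN (Nat.sub ab (Nat.mul 601 (slotQ LL ab))) fun C =>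
  forceN (Nat.mul (Nat.shiftRight C 26560) M) fun hm =>
  forceN (Nat.shiftRight (Nat.sub hm (Nat.mul 601 (slotQ LL hm))) 26496) fun X =>
  mmT F L LL ab X k

def frobN (F M L LL h : ℕ) (k : ℕ → Bool) : Bool :=
  mmN F M L LL h h fun a => mmN F M L LL a a fun a => mmN F M L LL a a fun a =>
  mmN F M L LL a h fun a => mmN F M L LL a a fun a => mmN F M L LL a a fun a =>
  mmN F M L LL a h fun a => mmN F M L LL a a fun a => mmN F M L LL a h fun a =>
  mmN F M L LL a a fun a => mmN F M L LL a a fun a => mmN F M L LL a a fun a =>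
  mmN F M L LL a h k

def frobI (F M L LL n : ℕ) : ℕ → (ℕ → Bool) → Bool :=
  Nat.rec (motive := fun _ => ℕ → (ℕ → Bool) → Bool) (fun h k => k h)
    (fun _ ih h k => frobN F M L LL h fun h' => ih h' k) n

@[irreducible] def BD : ℕ := 2 ^ 64
theorem BD_eq : BD = 2 ^ 64 := by unfold BD; rfl

def mainD : Bool :=
  forceN BD fun B =>
  forceN (pkL B gF fT) fun F => forceN (pkL B (fun a => a) muT) fun M =>
  forceN (lowN B 1023 415) fun L => forceN (lowN B 16777215 830) fun LL =>
  frobI F M L LL 5 B fun h5 =>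
  mmN F M L LL (h5 + 600 * B) (pkL B (fun a => a) vT) fun d =>
  bif Nat.beq d 1 then
  frobI F M L LL 78 h5 fun h83 =>
  mmN F M L LL (h83 + 600 * B) (pkL B (fun a => a) wT) fun d =>
  bif Nat.beq d 1 then
  frobI F M L LL 332 h83 fun h => Nat.beq h B
  else false else false

theorem mainD_true : mainD = true := by decide +kernel

end

open Polynomial in
theorem poly_uniq (B : ℕ) (hB : 0 < B) (n : ℕ) : ∀ P Q : ℕ[X], P.natDegree ≤ n → Q.natDegree ≤ n →
    (∀ i, P.coeff i < B) → (∀ i, Q.coeff i < B) → P.eval B = Q.eval B → P = Q := by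
  induction n with
  | zero =>
    intro P Q hP hQ _ _ h
    rw [Polynomial.eq_C_of_natDegree_le_zero hP, Polynomial.eq_C_of_natDegree_le_zero hQ] at h ⊢
    rw [eval_C, eval_C] at h
    rw [h]
  | succ n ih =>
    intro P Q hP hQ cP cQ h
    have eP := divX_mul_X_add P
    have eQ := divX_mul_X_add Q
    rw [← eP, ← eQ] at h
    simp only [eval_add, eval_mul, eval_X, eval_C] at h
    have h0 : P.coeff 0 = Q.coeff 0 := by
      have := congrArg (· % B) h
      simpa [Nat.add_mod, Nat.mod_eq_of_lt (cP 0), Nat.mod_eq_of_lt (cQ 0)] using this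
    have h1 : P.divX = Q.divX := by
      apply ih
      · rw [natDegree_divX_eq_natDegree_tsub_one]; omega
      · rw [natDegree_divX_eq_natDegree_tsub_one]; omega
      · intro i; rw [coeff_divX]; exact cP _
      · intro i; rw [coeff_divX]; exact cQ _
      · rw [h0] at h
        exact Nat.eq_of_mul_eq_mul_right hB (Nat.add_right_cancel h)
    rw [← eP, ← eQ, h0, h1]

open Polynomial in
theorem coeff_le_eval (P : ℕ[X]) (i : ℕ) : P.coeff i ≤ P.eval 1 := by
  rw [eval_eq_sum, Polynomial.sum]
  simp only [one_pow, mul_one]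
  by_cases h : i ∈ P.support
  · exact Finset.single_le_sum (f := fun i => P.coeff i) (fun _ _ => Nat.zero_le _) h
  · rw [notMem_support_iff.1 h]; exact Nat.zero_le _

open Polynomial in
theorem poly_uniq' (P Q : ℕ[X]) (hP : P.eval 1 < BD) (hQ : Q.eval 1 < BD)
    (h : P.eval BD = Q.eval BD) : P = Q :=
  poly_uniq BD (by omega) (max P.natDegree Q.natDegree) P Q (le_max_left _ _) (le_max_right _ _)
    (fun i => (coeff_le_eval P i).trans_lt hP) (fun i => (coeff_le_eval Q i).trans_lt hQ) h

theorem ofD_cons {A : Type} [CommSemiring A] (b : A) (a : ℕ) (l : List ℕ) :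
    Nat.ofDigits b (a :: l) = (a : A) + b * Nat.ofDigits b l := rfl

theorem ofD_map {A C : Type} [CommSemiring A] [CommSemiring C] (φ : A →+* C) (b : A) (l : List ℕ) :
    φ (Nat.ofDigits b l) = Nat.ofDigits (φ b) l := by
  induction l with
  | nil => simp [Nat.ofDigits]
  | cons a l ih => rw [ofD_cons, ofD_cons, map_add, map_mul, ih, map_natCast]

open Polynomial in
noncomputable def lP (l : List ℕ) : ℕ[X] := Nat.ofDigits (X : ℕ[X]) l

open Polynomial in
theorem lP_eval (b : ℕ) (l : List ℕ) : (lP l).eval b = Nat.ofDigits b l := by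
  have := ofD_map (evalRingHom b) (X : ℕ[X]) l
  simpa [lP] using this

open Polynomial in
theorem lP_ev {R : Type} [CommRing R] (α : R) (l : List ℕ) :
    (lP l).eval₂ (Nat.castRingHom R) α = Nat.ofDigits α l := by
  have := ofD_map (eval₂RingHom (Nat.castRingHom R) α) (X : ℕ[X]) l
  simpa [lP] using this

theorem lP_one (c : ℕ) (l : List ℕ) (h : ∀ x ∈ l, x ≤ c) : (lP l).eval 1 ≤ l.length * c := by
  rw [lP_eval, Nat.ofDigits_one]
  simpa using List.sum_le_card_nsmul l c h

theorem land_step (k a b c d : ℕ) (ha : a < 2 ^ k) (hc : c < 2 ^ k) :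
    (a + 2 ^ k * b) &&& (c + 2 ^ k * d) = (a &&& c) + 2 ^ k * (b &&& d) := by
  apply Nat.eq_of_testBit_eq
  intro j
  have hac : a &&& c < 2 ^ k := lt_of_le_of_lt Nat.and_le_left ha
  rw [Nat.testBit_and, add_comm a, add_comm c, add_comm (a &&& c),
    Nat.testBit_two_pow_mul_add _ ha, Nat.testBit_two_pow_mul_add _ hc,
    Nat.testBit_two_pow_mul_add _ hac]
  split_ifs <;> rw [Nat.testBit_and]

theorem land_low (c n : ℕ) (hc : c < BD) : ∀ X, ∃ l : List ℕ, l.length = n ∧ (∀ x ∈ l, x ≤ c) ∧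
    Nat.ofDigits BD l = X &&& lowN BD c n := by
  induction n with
  | zero => intro X; exact ⟨[], rfl, by simp, by change 0 = X &&& 0; simp⟩
  | succ n ih =>
    intro X
    obtain ⟨l, h1, h2, h3⟩ := ih (X / BD)
    have hB : 0 < BD := by omega
    refine ⟨(X % BD &&& c) :: l, by simp [h1], ?_, ?_⟩
    · intro x hx
      rcases List.mem_cons.1 hx with e | e
      · rw [e]; exact Nat.and_le_right
      · exact h2 x e
    · rw [Nat.ofDigits_cons, h3]
      change _ = X &&& (c + BD * lowN BD c n)
      conv_rhs => rw [← Nat.mod_add_div X BD]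
      have hm := Nat.mod_lt X hB
      generalize lowN BD c n = y
      generalize X / BD = z at *
      generalize X % BD = w at *
      rw [BD_eq] at *
      rw [land_step 64 _ _ _ _ hm hc]

theorem pkL_eq (B : ℕ) (g : ℕ → ℕ) (l : List ℕ) : pkL B g l = Nat.ofDigits B (l.map g) := by
  induction l with
  | nil => rfl
  | cons a l ih => rw [List.map_cons, Nat.ofDigits_cons, ← ih]; rfl

section
variable {R : Type} [CommRing R]

open Polynomial in
def RepD (α : R) (n : ℕ) (x : R) : Prop :=
  ∃ P : ℕ[X], P.eval 1 ≤ 1048576 ∧ P.eval BD = n ∧ P.eval₂ (Nat.castRingHom R) α = x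

open Polynomial in
def RepE (α : R) (n : ℕ) (x : R) : Prop :=
  ∃ P : ℕ[X], P.eval 1 ≤ 2097152 ∧ P.eval BD = n ∧ P.eval₂ (Nat.castRingHom R) α = x

theorem RepE_of {α : R} {n : ℕ} {x : R} (h : RepD α n x) : RepE α n x := by
  obtain ⟨P, a1, a2⟩ := h
  exact ⟨P, by omega, a2⟩

theorem RepE_add {α : R} {n : ℕ} {x : R} (h : RepD α n x) :
    RepE α (n + 600 * BD) (x + 600 * α) := by
  obtain ⟨P, a1, a2, a3⟩ := h
  refine ⟨P + 600 * Polynomial.X, ?_, ?_, ?_⟩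
  · simp only [Polynomial.eval_add, Polynomial.eval_mul, Polynomial.eval_ofNat, Polynomial.eval_X]
    omega
  · simp only [Polynomial.eval_add, Polynomial.eval_mul, Polynomial.eval_ofNat, Polynomial.eval_X, a2]
  · rw [Polynomial.eval₂_add, Polynomial.eval₂_mul, Polynomial.eval₂_ofNat, Polynomial.eval₂_X, a3]

theorem RepD_uniq {α : R} {n : ℕ} {x y : R} (h1 : RepD α n x) (h2 : RepD α n y) : x = y := by
  obtain ⟨P, a1, a2, a3⟩ := h1
  obtain ⟨Q, b1, b2, b3⟩ := h2
  have hB : 1048576 < BD := by rw [BD_eq]; norm_num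
  rw [← a3, ← b3, poly_uniq' P Q (by omega) (by omega) (a2.trans b2.symm)]

theorem RepD_list (α : R) (l : List ℕ) (c : ℕ) (h : ∀ x ∈ l, x ≤ c) (hl : l.length * c ≤ 1048576) :
    RepD α (Nat.ofDigits BD l) (Nat.ofDigits α l) :=
  ⟨lP l, (lP_one c l h).trans hl, lP_eval _ _, lP_ev _ _⟩


theorem RepD_low (α : R) (X : ℕ) : ∃ x, RepD α (X &&& lowN BD 1023 415) x := by
  obtain ⟨l, h1, h2, h3⟩ := land_low 1023 415 (by rw [BD_eq]; norm_num) X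
  rw [← h3]
  exact ⟨_, RepD_list α l 1023 h2 (by rw [h1]; norm_num)⟩

theorem mmT_spec (h601 : (601 : R) = 0) (α : R) (F : ℕ) (hF : RepD α F 0) (a b X : ℕ) (x y : R)
    (ha : RepE α a x) (hb : RepD α b y) (k : ℕ → Bool)
    (h : mmT F (lowN BD 1023 415) (lowN BD 16777215 830) (a * b) X k = true) :
    ∃ D, RepD α D (x * y) ∧ k D = true := by
  rw [mmT, forceN_eq, forceN_eq, forceN_eq, forceN_eq, forceN_eq] at h
  obtain ⟨h1, h2⟩ := cond_and h
  refine ⟨_, ?_, h2⟩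
  clear h h2 k
  have h1 := Nat.eq_of_beq_eq_true h1
  generalize Nat.shiftRight _ 40 = Y at *
  obtain ⟨z, hz⟩ := RepD_low α X
  obtain ⟨d, hd⟩ := RepD_low α ((Nat.add (a * b) (Nat.mul (Nat.land X (lowN BD 1023 415)) F)).sub
    (Nat.mul 601 (Nat.land Y (lowN BD 16777215 830))))
  obtain ⟨l, l1, l2, l3⟩ := land_low 16777215 830 (by rw [BD_eq]; norm_num) Y
  have key : x * y = d := by
    change (((a * b + (X &&& lowN BD 1023 415) * F) - 601 * (Y &&& lowN BD 16777215 830)) &&&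
      lowN BD 1023 415) + 601 * (Y &&& lowN BD 16777215 830) =
        a * b + (X &&& lowN BD 1023 415) * F at h1
    change RepD α (((a * b + (X &&& lowN BD 1023 415) * F) - 601 * (Y &&& lowN BD 16777215 830)) &&&
      lowN BD 1023 415) d at hd
    generalize ((a * b + (X &&& lowN BD 1023 415) * F) - 601 * (Y &&& lowN BD 16777215 830)) &&&
      lowN BD 1023 415 = D at *
    rw [← l3] at h1
    generalize X &&& lowN BD 1023 415 = q at *
    obtain ⟨PA, a1, a2, a3⟩ := ha
    obtain ⟨PB, b1, b2, b3⟩ := hb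
    obtain ⟨PF, f1, f2, f3⟩ := hF
    obtain ⟨PQ, q1, q2, q3⟩ := hz
    obtain ⟨PD, d1, d2, d3⟩ := hd
    have l4 := lP_one 16777215 l l2
    rw [l1] at l4
    have hl := lP_eval BD l
    have m1 := Nat.mul_le_mul a1 b1
    have m2 := Nat.mul_le_mul q1 f1
    have e : PD + 601 * lP l = PA * PB + PQ * PF := by
      apply poly_uniq'
      · simp only [Polynomial.eval_add, Polynomial.eval_mul, Polynomial.eval_ofNat, BD_eq]
        omega
      · simp only [Polynomial.eval_add, Polynomial.eval_mul, BD_eq]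
        omega
      · simp only [Polynomial.eval_add, Polynomial.eval_mul, Polynomial.eval_ofNat]
        rw [d2, hl, h1, a2, b2, q2, f2]
    have e2 := congrArg (Polynomial.eval₂ (Nat.castRingHom R) α) e
    simp only [Polynomial.eval₂_add, Polynomial.eval₂_mul] at e2
    rw [Polynomial.eval₂_ofNat, a3, b3, f3, d3] at e2
    rw [mul_zero, add_zero] at e2
    rw [← e2, h601, zero_mul, add_zero]
  rw [key]
  exact hd

theorem mm_spec (h601 : (601 : R) = 0) (α : R) (F M : ℕ) (hF : RepD α F 0) {a b : ℕ} {x y : R}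
    (ha : RepE α a x) (hb : RepD α b y) {k : ℕ → Bool}
    (h : mmN F M (lowN BD 1023 415) (lowN BD 16777215 830) a b k = true) :
    ∃ D, RepD α D (x * y) ∧ k D = true := by
  rw [mmN, forceN_eq, forceN_eq, forceN_eq, forceN_eq] at h
  exact mmT_spec h601 α F hF a b _ x y ha hb k h

theorem frobN_spec (h601 : (601 : R) = 0) (α : R) (F M : ℕ) (hF : RepD α F 0) {h : ℕ} {x : R}
    (ha : RepD α h x) {k : ℕ → Bool}
    (hk : frobN F M (lowN BD 1023 415) (lowN BD 16777215 830) h k = true) :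
    ∃ D, RepD α D (x ^ 601) ∧ k D = true := by
  rw [frobN] at hk
  obtain ⟨_, h1, hk⟩ := mm_spec h601 α F M hF (RepE_of ha) ha hk
  obtain ⟨_, h1, hk⟩ := mm_spec h601 α F M hF (RepE_of h1) h1 hk
  obtain ⟨_, h1, hk⟩ := mm_spec h601 α F M hF (RepE_of h1) h1 hk
  obtain ⟨_, h1, hk⟩ := mm_spec h601 α F M hF (RepE_of h1) ha hk
  obtain ⟨_, h1, hk⟩ := mm_spec h601 α F M hF (RepE_of h1) h1 hk
  obtain ⟨_, h1, hk⟩ := mm_spec h601 α F M hF (RepE_of h1) h1 hk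
  obtain ⟨_, h1, hk⟩ := mm_spec h601 α F M hF (RepE_of h1) ha hk
  obtain ⟨_, h1, hk⟩ := mm_spec h601 α F M hF (RepE_of h1) h1 hk
  obtain ⟨_, h1, hk⟩ := mm_spec h601 α F M hF (RepE_of h1) ha hk
  obtain ⟨_, h1, hk⟩ := mm_spec h601 α F M hF (RepE_of h1) h1 hk
  obtain ⟨_, h1, hk⟩ := mm_spec h601 α F M hF (RepE_of h1) h1 hk
  obtain ⟨_, h1, hk⟩ := mm_spec h601 α F M hF (RepE_of h1) h1 hk
  obtain ⟨D, h1, hk⟩ := mm_spec h601 α F M hF (RepE_of h1) ha hk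
  refine ⟨D, ?_, hk⟩
  convert h1 using 1
  ring

theorem frobI_spec (h601 : (601 : R) = 0) (α : R) (F M : ℕ) (hF : RepD α F 0) (n : ℕ) :
    ∀ (h : ℕ) (x : R), RepD α h x → ∀ k : ℕ → Bool,
    frobI F M (lowN BD 1023 415) (lowN BD 16777215 830) n h k = true →
    ∃ D, RepD α D (x ^ 601 ^ n) ∧ k D = true := by
  induction n with
  | zero => intro h x hx k hk; exact ⟨h, by simpa using hx, hk⟩
  | succ n ih =>
    intro h x hx k hk
    obtain ⟨D, h1, hk⟩ := frobN_spec h601 α F M hF hx hk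
    obtain ⟨D, h1, hk⟩ := ih D _ h1 k hk
    refine ⟨D, ?_, hk⟩
    rw [pow_succ', pow_mul]
    exact h1

end

theorem dat_facts : lenL muT 0 = 415 ∧ lenL vT 0 = 415 ∧ lenL wT 0 = 415 ∧
    allL (fun c => Nat.ble c 600) vT = true ∧ allL (fun c => Nat.ble c 600) wT = true := by
  decide +kernel

theorem RepD_X {R : Type} [CommRing R] (α : R) : RepD α BD α :=
  ⟨Polynomial.X, by simp, by simp, by simp⟩

theorem RepD_one {R : Type} [CommRing R] (α : R) : RepD α 1 1 :=
  ⟨1, by simp, by simp, by simp⟩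

theorem RepD_dat {R : Type} [CommRing R] (α : R) (l : List ℕ) (h1 : lenL l 0 = 415)
    (h2 : allL (fun c => Nat.ble c 600) l = true) :
    ∃ v, RepD α (pkL BD (fun a => a) l) v := by
  rw [lenL_eq] at h1
  have e : l.map (fun a => a) = l := List.map_id _
  rw [pkL_eq, e]
  refine ⟨_, RepD_list α l 600 ?_ ?_⟩
  · intro x hx
    have := allL_spec _ _ h2 x hx
    rwa [Nat.ble_eq] at this
  · have h3 : l.length = 415 := by omega
    rw [h3]; norm_num

theorem gF_ev {R : Type} [CommRing R] (h601 : (601 : R) = 0) (α : R) (l : List ℕ)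
    (hl : ∀ c ∈ l, c ≤ 20000000000000) :
    Nat.ofDigits α (l.map gF) = - evL (l.map fun c : ℕ => (c : ℤ) - (offF : ℤ)) α := by
  induction l with
  | nil => simp [evL, Nat.ofDigits]
  | cons c l ih =>
    rw [List.map_cons, ofD_cons, ih (fun c h => hl c (List.mem_cons_of_mem _ h)), List.map_cons, evL]
    have hc := hl c (by simp)
    have e : (gF c : ℤ) = 22020000000000 - c - 601 * ((22020000000000 - c) / 601 : ℤ) := by
      unfold gF; omega
    have e2 : (gF c : R) = ((gF c : ℤ) : R) := by push_cast; rfl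
    have e3 : ((22020000000000 : ℤ) : R) = ((offF : ℤ) : R) := by
      have : (22020000000000 : ℤ) = (offF : ℤ) + 601 * 20000000000 := by unfold offF; norm_num
      rw [this]; push_cast; linear_combination 20000000000 * h601
    rw [e2, e]
    generalize (22020000000000 - (c : ℤ)) / 601 = z
    rw [Int.cast_sub, Int.cast_sub, e3, Int.cast_mul]
    have e4 : ((601 : ℤ) : R) = 0 := by exact_mod_cast h601
    rw [e4, Int.cast_sub]
    ring

theorem RepD_F {R : Type} [CommRing R] (h601 : (601 : R) = 0) (α : R) (hα : evL fZ α = 0) :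
    RepD α (pkL BD gF fT) 0 := by
  have hl : ∀ c ∈ fT, c ≤ 20000000000000 := by
    intro c hc
    have := allL_spec _ _ fT_facts.2 c hc
    rwa [Nat.ble_eq] at this
  have h := gF_ev h601 α fT hl
  rw [← fZ, hα, neg_zero] at h
  rw [pkL_eq, ← h]
  refine RepD_list α (fT.map gF) 600 ?_ ?_
  · intro x hx
    obtain ⟨y, _, rfl⟩ := List.mem_map.1 hx
    have : gF y < 601 := Nat.mod_lt _ (by norm_num)
    omega
  · rw [List.length_map, fT_len]; norm_num

theorem mainD_spec {R : Type} [CommRing R] (h601 : (601 : R) = 0) (α : R) (hα : evL fZ α = 0) :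
    α ^ 601 ^ 415 = α ∧ (∃ v, (α ^ 601 ^ 5 - α) * v = 1) ∧ (∃ v, (α ^ 601 ^ 83 - α) * v = 1) := by
  have hF := RepD_F h601 α hα
  have h := mainD_true
  rw [mainD, forceN_eq, forceN_eq, forceN_eq, forceN_eq, forceN_eq] at h
  generalize pkL BD gF fT = F at *
  generalize pkL BD (fun a => a) muT = M at *
  obtain ⟨_, f1, f2, f3, f4⟩ := dat_facts
  obtain ⟨v, hv⟩ := RepD_dat α vT f1 f3
  obtain ⟨w, hw⟩ := RepD_dat α wT f2 f4
  have n600 : (600 : R) = -1 := by linear_combination h601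
  obtain ⟨h5, r5, h⟩ := frobI_spec h601 α F M hF 5 BD α (RepD_X α) _ h
  obtain ⟨d, rd, h⟩ := mm_spec h601 α F M hF (RepE_add r5) hv h
  obtain ⟨c1, h⟩ := cond_and h
  have c1 := Nat.eq_of_beq_eq_true c1
  rw [c1] at rd
  have g1 := RepD_uniq rd (RepD_one α)
  obtain ⟨h83, r83, h⟩ := frobI_spec h601 α F M hF 78 _ _ r5 _ h
  obtain ⟨d2, rd2, h⟩ := mm_spec h601 α F M hF (RepE_add r83) hw h
  obtain ⟨c2, h⟩ := cond_and h
  have c2 := Nat.eq_of_beq_eq_true c2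
  rw [c2] at rd2
  have g2 := RepD_uniq rd2 (RepD_one α)
  obtain ⟨h415, r415, h⟩ := frobI_spec h601 α F M hF 332 _ _ r83 _ h
  have c3 := Nat.eq_of_beq_eq_true h
  rw [c3] at r415
  have g3 := RepD_uniq r415 (RepD_X α)
  have pm : ∀ a b : ℕ, (α ^ 601 ^ a) ^ 601 ^ b = α ^ 601 ^ (a + b) := by
    intro a b; rw [← pow_mul, ← pow_add]
  rw [pm] at g2 g3
  rw [pm] at g3
  refine ⟨g3, ⟨v, ?_⟩, ⟨w, ?_⟩⟩
  · rw [← g1, n600]; ring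
  · rw [← g2, n600]; ring

theorem evL_hom {R S : Type} [CommRing R] [CommRing S] (φ : R →+* S) (cs : List ℤ) (x : R) :
    φ (evL cs x) = evL cs (φ x) := by
  induction cs with
  | nil => simp [evL]
  | cons c cs ih => simp only [evL, map_add, map_mul, ih, map_intCast]

open Polynomial in
theorem evL_append {R : Type} [CommRing R] (l : List ℤ) (x : R) :
    evL (l ++ [1]) x = evL l x + x ^ l.length := by
  induction l with
  | nil => simp [evL]
  | cons c l ih => simp only [List.cons_append, evL, ih, List.length_cons]; ring

open Polynomial in
theorem evL_deg {R : Type} [CommRing R] (l : List ℤ) :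
    (evL l (X : R[X])).degree < l.length := by
  rw [degree_lt_iff_coeff_zero]
  induction l with
  | nil => simp [evL]
  | cons c l ih =>
    intro m hm
    simp only [List.length_cons] at hm
    obtain ⟨k, rfl⟩ : ∃ k, m = k + 1 := ⟨m - 1, by omega⟩
    rw [evL, coeff_add, coeff_X_mul, ih k (by omega), add_zero, ← C_eq_intCast, coeff_C]
    simp

open Polynomial in
theorem fP_form {R : Type} [CommRing R] [Nontrivial R] :
    (evL fZ (X : R[X])).Monic ∧ (evL fZ (X : R[X])).natDegree = 415 := by
  have hlen : fZ.length = 416 := by rw [fZ, List.length_map, fT_len]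
  have hlast : fZ.getLast? = some 1 := by
    rw [fZ, List.getLast?_map]
    have : fT.getLast? = some 10000000000001 := by decide +kernel
    rw [this]; rfl
  obtain ⟨l, hl⟩ : ∃ l, fZ = l ++ [1] := List.getLast?_eq_some_iff.1 hlast
  have hl2 : l.length = 415 := by
    rw [hl] at hlen; simpa using hlen
  have hd := evL_deg (R := R) l
  rw [hl, evL_append, add_comm, ← hl2]
  generalize l.length = n at hd
  exact ⟨monic_X_pow_add hd, by
    rw [natDegree_add_eq_left_of_degree_lt (by rw [degree_X_pow]; exact hd), natDegree_X_pow]⟩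

theorem prime601 : Nat.Prime 601 := by norm_num
instance fact601 : Fact (Nat.Prime 601) := ⟨prime601⟩

theorem frob_gcd {K : Type} [Field K] (α : K) (a b : ℕ) (ha : α ^ 601 ^ a = α)
    (hb : α ^ 601 ^ b = α) : α ^ 601 ^ (Nat.gcd a b) = α := by
  have h : ∀ n, (fun x : K => x ^ 601)^[n] α = α ^ 601 ^ n := by
    intro n
    induction n with
    | zero => simp
    | succ n ih => rw [Function.iterate_succ_apply', ih, ← pow_mul, ← pow_succ]
  have pa : Function.IsPeriodicPt (fun x : K => x ^ 601) a α := (h a).trans ha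
  have pb : Function.IsPeriodicPt (fun x : K => x ^ 601) b α := (h b).trans hb
  have := pa.gcd pb
  rw [← h]; exact this

theorem frob_dvd {K : Type} [Field K] (α : K) (a b : ℕ) (hab : a ∣ b) (ha : α ^ 601 ^ a = α) :
    α ^ 601 ^ b = α := by
  obtain ⟨c, rfl⟩ := hab
  induction c with
  | zero => simp
  | succ c ih => rw [Nat.mul_succ, pow_add, pow_mul, ih, ha]

open Polynomial in
theorem fP_irr : Irreducible (evL fZ (X : (ZMod 601)[X])) := by
  obtain ⟨hm, hd⟩ := fP_form (R := ZMod 601)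
  set f := evL fZ (X : (ZMod 601)[X]) with hf
  have hnu : ¬ IsUnit f := by
    intro h
    have := natDegree_eq_zero_of_isUnit h
    omega
  obtain ⟨g, hg, hgf⟩ := WfDvdMonoid.exists_irreducible_factor hnu hm.ne_zero
  have : Fact (Irreducible g) := ⟨hg⟩
  have hg0 : g ≠ 0 := hg.ne_zero
  set α := AdjoinRoot.root g with hα
  have hroot : evL fZ α = 0 := by
    have e : evL fZ α = AdjoinRoot.mk g f := by rw [hf, evL_hom, AdjoinRoot.mk_X]
    rw [e, AdjoinRoot.mk_eq_zero]
    exact hgf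
  have h601 : (601 : AdjoinRoot g) = 0 := by
    have e : (601 : ZMod 601) = 0 := by decide
    have := congrArg (AdjoinRoot.of g) e
    rwa [map_ofNat, map_zero] at this
  obtain ⟨r1, ⟨v, r2⟩, ⟨w, r3⟩⟩ := mainD_spec h601 α hroot
  have hpow : α ^ 601 ^ g.natDegree = α := by
    let pb := AdjoinRoot.powerBasis hg0
    have : Module.Finite (ZMod 601) (AdjoinRoot g) := pb.finite
    have : Finite (AdjoinRoot g) := Module.finite_of_finite (ZMod 601)
    have := Fintype.ofFinite (AdjoinRoot g)
    have hc : Fintype.card (AdjoinRoot g) = 601 ^ g.natDegree := by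
      rw [← Nat.card_eq_fintype_card, Module.natCard_eq_pow_finrank (K := ZMod 601), pb.finrank,
        AdjoinRoot.powerBasis_dim, Nat.card_zmod]
    rw [← hc]
    exact FiniteField.pow_card α
  have hgcd := frob_gcd α _ _ hpow r1
  have n5 : ¬ (Nat.gcd g.natDegree 415 ∣ 5) := by
    intro h
    rw [frob_dvd α _ _ h hgcd, sub_self, zero_mul] at r2
    exact zero_ne_one r2
  have n83 : ¬ (Nat.gcd g.natDegree 415 ∣ 83) := by
    intro h
    rw [frob_dvd α _ _ h hgcd, sub_self, zero_mul] at r3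
    exact zero_ne_one r3
  have hdv : Nat.gcd g.natDegree 415 ∣ 415 := Nat.gcd_dvd_right _ _
  have h415 : Nat.gcd g.natDegree 415 = 415 := by
    have hmem : Nat.gcd g.natDegree 415 ∈ Nat.divisors 415 := Nat.mem_divisors.2 ⟨hdv, by norm_num⟩
    have e : Nat.divisors 415 = {1, 5, 83, 415} := by decide +kernel
    rw [e] at hmem
    generalize Nat.gcd g.natDegree 415 = z at *
    simp only [Finset.mem_insert, Finset.mem_singleton] at hmem
    rcases hmem with rfl | rfl | rfl | rfl
    · exact absurd (one_dvd _) n5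
    · exact absurd (dvd_refl _) n5
    · exact absurd (dvd_refl _) n83
    · rfl
  have hdg : 415 ∣ g.natDegree := by rw [← h415]; exact Nat.gcd_dvd_left _ _
  have hge : 415 ≤ g.natDegree := Nat.le_of_dvd hg.natDegree_pos hdg
  have hassoc : Associated g f := by
    obtain ⟨q, hq⟩ := hgf
    have hq0 : q ≠ 0 := by rintro rfl; rw [mul_zero] at hq; exact hm.ne_zero hq
    have hdq : q.natDegree = 0 := by
      have := natDegree_mul hg0 hq0
      rw [← hq, hd] at this
      omega
    have hu : IsUnit q := by
      rw [eq_C_of_natDegree_eq_zero hdq] at hq0 ⊢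
      rw [isUnit_C]
      exact isUnit_iff_ne_zero.2 (fun h => hq0 (by rw [h, C_0]))
    rw [hq]
    exact (associated_mul_unit_right g q hu)
  exact hassoc.irreducible hg

open Polynomial in
theorem fQ_irr : Irreducible (evL fZ (X : ℚ[X])) := by
  obtain ⟨hm, hd⟩ := fP_form (R := ℤ)
  have h1 : Irreducible (evL fZ (X : ℤ[X])) := by
    apply hm.irreducible_of_irreducible_map (Int.castRingHom (ZMod 601))
    have := evL_hom (mapRingHom (Int.castRingHom (ZMod 601))) fZ X
    rw [coe_mapRingHom, map_X] at this
    rw [this]; exact fP_irr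
  have h2 := (hm.irreducible_iff_irreducible_map_fraction_map (K := ℚ)).1 h1
  have := evL_hom (mapRingHom (algebraMap ℤ ℚ)) fZ X
  rw [coe_mapRingHom, map_X] at this
  rwa [this] at h2

open Polynomial in
theorem lam_alg (lam : ℝ) (h : evL fZ lam = 0) :
    IsIntegral ℤ lam ∧ (minpoly ℚ lam).natDegree = 415 := by
  constructor
  · refine ⟨evL fZ (X : ℤ[X]), (fP_form (R := ℤ)).1, ?_⟩
    have := evL_hom (eval₂RingHom (algebraMap ℤ ℝ) lam) fZ X
    rw [coe_eval₂RingHom, eval₂_X] at this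
    rw [this, h]
  · obtain ⟨hm, hd⟩ := fP_form (R := ℚ)
    have e : aeval lam (evL fZ (X : ℚ[X])) = 0 := by
      have := evL_hom (aeval lam : ℚ[X] →ₐ[ℚ] ℝ).toRingHom fZ X
      simp only [AlgHom.toRingHom_eq_coe, RingHom.coe_coe, aeval_X] at this
      rw [this, h]
    rw [← minpoly.eq_of_irreducible_of_monic fQ_irr e hm]
    exact hd

theorem len_R (n : ℕ) : (((say^[n + 1] ([0] : List (Fin 10))).length : ℕ) : ℝ) = uR n 0 := by
  rw [len_eq, uR]

theorem main_result :
    ∃ lam : ℝ, 1.4453300117 ≤ lam ∧ lam ≤ 1.4453300118 ∧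
      Filter.Tendsto
        (fun n : ℕ =>
          ((say^[n + 1] ([0] : List (Fin 10))).length : ℝ) /
            ((say^[n] ([0] : List (Fin 10))).length : ℝ))
        Filter.atTop (nhds lam) ∧
      IsIntegral ℤ lam ∧ (minpoly ℚ lam).natDegree = 415 := by
  obtain ⟨lam, h1, h2, hp, ht⟩ := lam_ex
  have hr := lam_root lam hp ht
  refine ⟨lam, le_trans (by norm_num) h1, le_trans h2 (by norm_num), ?_, lam_alg lam hr⟩
  rw [← Filter.tendsto_add_atTop_iff_nat 1]
  refine ht.congr fun n => ?_
  rw [len_R, len_R]
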